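/- arXiv:1108.1900 — 9 statements merged into one kernel-verified Lean document; each statement's English description precedes it below -/
import Mathlib

section
/- Let f, g, p, q be nonconstant polynomials over ℂ such that f ∘ p = g ∘ q, the bivariate polynomial f(X) − g(Y) is irreducible in ℂ[X,Y], and p and q have no nontrivial common right compositional factor. Then for every z ∈ ℂ the local degrees e_z(p) and e_z(q) are coprime, i.e. gcd(e_z(p), e_z(q)) = 1. -/
open Polynomial

/-- The local degree of a polynomial `p` at a point `z`: the multiplicity of `z`
as a root of `p(X) - p(z)`. -/
noncomputable def localDeg (p : Polynomial ℂ) (z : ℂ) : ℕ :=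
  rootMultiplicity z (p - C (p.eval z))

/-- `p` and `q` have no nontrivial common right compositional factor. -/
def NoCommonRightFactor (p q : Polynomial ℂ) : Prop :=
  ∀ p₁ q₁ W : Polynomial ℂ, p = p₁.comp W → q = q₁.comp W → W.natDegree ≤ 1

/-- The bivariate polynomial `f(X) - g(Y)`, viewed as an element of `(ℂ[X])[Y]`. -/
noncomputable def curvePoly (f g : Polynomial ℂ) : Polynomial (Polynomial ℂ) :=
  C f - g.map C

open IntermediateField

lemma constantCoeff_aeval (P : ℂ[X]) (A : PowerSeries ℂ) :
    PowerSeries.constantCoeff (aeval A P) = P.eval (PowerSeries.constantCoeff A) := by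
  have h1 : (PowerSeries.constantCoeff (R := ℂ)).comp (algebraMap ℂ (PowerSeries ℂ))
      = RingHom.id ℂ := by ext x; simp
  rw [aeval_def, hom_eval₂, h1, eval₂_eq_eval_map, Polynomial.map_id]

/-- Two power series with a common constant coefficient, the same order and the same leading
coefficient that have equal images under a nonconstant polynomial are equal. -/
lemma eq_of_aeval_eq_of_leading_eq {f : ℂ[X]} (hf : 0 < f.natDegree) {c b : ℂ} (hb : b ≠ 0)
    {e : ℕ} (he : 0 < e) {A B A' B' : PowerSeries ℂ}
    (hA : A = PowerSeries.C c + PowerSeries.X ^ e * A')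
    (hB : B = PowerSeries.C c + PowerSeries.X ^ e * B')
    (hA' : PowerSeries.constantCoeff A' = b) (hB' : PowerSeries.constantCoeff B' = b)
    (h : aeval A f = aeval B f) : A = B := by
  have hf0 : f - C (f.eval c) ≠ 0 := by
    intro h0
    rw [sub_eq_zero.mp h0, natDegree_C] at hf
    exact lt_irrefl _ hf
  obtain ⟨F, hF, hFc⟩ := exists_eq_pow_rootMultiplicity_mul_and_not_dvd _ hf0 c
  have ha : 0 < rootMultiplicity c (f - C (f.eval c)) := by
    rw [rootMultiplicity_pos hf0]; simp
  set a := rootMultiplicity c (f - C (f.eval c))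
  rw [dvd_iff_isRoot, IsRoot.def] at hFc
  have key : ∀ D D' : PowerSeries ℂ, D = PowerSeries.C c + PowerSeries.X ^ e * D' →
      aeval D f - PowerSeries.C (f.eval c) = (PowerSeries.X ^ e) ^ a * (D' ^ a * aeval D F) := by
    intro D D' hD
    have h1 := congrArg (aeval D) hF
    simp only [map_sub, map_mul, map_pow, aeval_X, aeval_C] at h1
    have h2 : ∀ x : ℂ, algebraMap ℂ (PowerSeries ℂ) x = PowerSeries.C x := fun x ↦ rfl
    rw [h2, h2] at h1
    rw [h1]
    have : D - PowerSeries.C c = PowerSeries.X ^ e * D' := by rw [hD]; ring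
    rw [this]; ring
  have h1 : A' ^ a * aeval A F = B' ^ a * aeval B F := by
    have hX : ((PowerSeries.X : PowerSeries ℂ) ^ e) ^ a ≠ 0 :=
      pow_ne_zero _ (pow_ne_zero _ PowerSeries.X_ne_zero)
    apply mul_left_cancel₀ hX
    rw [← key A A' hA, ← key B B' hB, h]
  obtain ⟨S, hS⟩ : ∃ S : PowerSeries ℂ, S = ∑ i ∈ Finset.range a, A' ^ i * B' ^ (a - 1 - i) :=
    ⟨_, rfl⟩
  have hS' : A' ^ a - B' ^ a = (A' - B') * S := by
    rw [hS, mul_comm, (Commute.all A' B').geom_sum₂_mul]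
  have hS0 : PowerSeries.constantCoeff S = a * b ^ (a - 1) := by
    rw [hS, map_sum, Finset.sum_congr rfl (g := fun _ ↦ b ^ (a - 1))]
    · simp
    · intro i hi
      rw [map_mul, map_pow, map_pow, hA', hB', ← pow_add]
      congr 1
      have := Finset.mem_range.mp hi
      omega
  obtain ⟨R, hR⟩ : A - B ∣ aeval A F - aeval B F := by
    simpa [aeval_def, eval₂_eq_eval_map] using
      sub_dvd_eval_sub A B (F.map (algebraMap ℂ (PowerSeries ℂ)))
  have hAB : A - B = PowerSeries.X ^ e * (A' - B') := by rw [hA, hB]; ring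
  have hprod : (A' - B') * (S * aeval A F + B' ^ a * (PowerSeries.X ^ e * R)) = 0 := by
    have : A' ^ a * aeval A F - B' ^ a * aeval B F
        = (A' ^ a - B' ^ a) * aeval A F + B' ^ a * (aeval A F - aeval B F) := by ring
    rw [h1, sub_self, hS', hR, hAB] at this
    rw [this]; ring
  have hA0 : PowerSeries.constantCoeff A = c := by
    rw [hA]; simp [he.ne']
  have hFA : PowerSeries.constantCoeff (aeval A F) = F.eval c := by
    rw [constantCoeff_aeval, hA0]
  rcases mul_eq_zero.mp hprod with h0 | h0
  · rw [← sub_eq_zero, hAB, h0, mul_zero]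
  · exfalso
    have h3 := congrArg PowerSeries.constantCoeff h0
    simp only [map_add, map_mul, map_pow, hS0, hFA, PowerSeries.constantCoeff_X, zero_pow he.ne',
      zero_mul, mul_zero, add_zero, map_zero] at h3
    have ha' : (a : ℂ) ≠ 0 := Nat.cast_ne_zero.mpr ha.ne'
    exact mul_ne_zero (mul_ne_zero ha' (pow_ne_zero _ hb)) hFc h3

/-- If `u(0) ≠ 0` and `ζ ^ N = 1`, the equation `ρ ^ N * u(tρ) = u(t)` has a power series
solution `ρ` with constant coefficient `ζ`. -/
lemma exists_powerSeries_pow_mul_aeval_eq {u : ℂ[X]} (hu : u.eval 0 ≠ 0) {N : ℕ} (hN : 0 < N)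
    {ζ : ℂ} (hζ : ζ ^ N = 1) :
    ∃ ρ : PowerSeries ℂ, PowerSeries.constantCoeff ρ = ζ ∧
      ρ ^ N * aeval (PowerSeries.X * ρ) u = aeval (PowerSeries.X : PowerSeries ℂ) u := by
  have hζ0 : ζ ≠ 0 := by
    rintro rfl
    rw [zero_pow hN.ne'] at hζ
    exact zero_ne_one hζ
  set M := u.natDegree
  set U : PowerSeries ℂ := aeval (PowerSeries.X : PowerSeries ℂ) u with hU
  have hU0 : PowerSeries.constantCoeff U = u.coeff 0 := by
    rw [hU, aeval_eq_sum_range, map_sum, Finset.sum_range_succ']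
    simp
  have hu0 : u.coeff 0 ≠ 0 := by rwa [coeff_zero_eq_eval_zero]
  have hUinv : U * U⁻¹ = 1 := PowerSeries.mul_inv_cancel U (by rwa [hU0])
  have hUinv0 : PowerSeries.constantCoeff U⁻¹ = (u.coeff 0)⁻¹ := by
    rw [PowerSeries.constantCoeff_inv, hU0]
  obtain ⟨T, hT⟩ : ∃ T : (PowerSeries ℂ)[X], T = ∑ i ∈ Finset.range (M + 1),
    C (PowerSeries.C (u.coeff i) * PowerSeries.X ^ i) * X ^ (M + 1 - i) := ⟨_, rfl⟩
  obtain ⟨G, hG'⟩ : ∃ G : (PowerSeries ℂ)[X], G = X ^ (N + M + 1) - C U⁻¹ * T := ⟨_, rfl⟩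
  have hG : G.Monic := by
    rw [hG']
    apply monic_X_pow_sub
    have hTdeg : T.degree ≤ ((N + M : ℕ) : WithBot ℕ) := by
      rw [hT]
      refine (degree_sum_le _ _).trans (Finset.sup_le fun i hi ↦ ?_)
      refine (degree_C_mul_X_pow_le _ _).trans ?_
      exact_mod_cast (by omega : M + 1 - i ≤ N + M)
    rw [← smul_eq_C_mul]
    refine ((degree_smul_le _ _).trans hTdeg).trans_lt ?_
    exact_mod_cast Nat.lt_succ_self (N + M)
  let η : PowerSeries ℂ := PowerSeries.C ζ⁻¹
  have hη : ζ⁻¹ ^ N = 1 := by rw [inv_pow, hζ, inv_one]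
  have hGmap : G.map PowerSeries.constantCoeff = X ^ (N + M + 1) - X ^ (M + 1) := by
    have hTmap : T.map PowerSeries.constantCoeff = C (u.coeff 0) * X ^ (M + 1) := by
      rw [hT, Polynomial.map_sum, Finset.sum_range_succ']
      simp
    rw [hG', Polynomial.map_sub, Polynomial.map_mul, hTmap, map_C, hUinv0, ← mul_assoc, ← C_mul,
      inv_mul_cancel₀ hu0]
    simp
  have hev : ∀ P : (PowerSeries ℂ)[X], PowerSeries.constantCoeff (P.eval η)
      = (P.map PowerSeries.constantCoeff).eval ζ⁻¹ := by
    intro P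
    rw [← Polynomial.eval₂_at_apply, eval_map]
    simp [η]
  have hmem : ∀ x : PowerSeries ℂ, x ∈ Ideal.span {(PowerSeries.X : PowerSeries ℂ)} ↔
      PowerSeries.constantCoeff x = 0 := by
    intro x
    rw [Ideal.mem_span_singleton, PowerSeries.X_dvd_iff]
  obtain ⟨κ, hκ, hκη⟩ := HenselianRing.is_henselian
    (I := Ideal.span {(PowerSeries.X : PowerSeries ℂ)}) G hG η
    (by
      rw [hmem, hev, hGmap]
      simp only [eval_sub, eval_pow, eval_X]
      rw [add_assoc, pow_add, hη, one_mul, sub_self])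
    (by
      apply IsUnit.map
      rw [PowerSeries.isUnit_iff_constantCoeff, hev, ← derivative_map, hGmap]
      simp only [derivative_sub, derivative_X_pow, eval_sub, eval_mul, eval_pow, eval_X, eval_C,
        Nat.add_sub_cancel]
      rw [pow_add, hη, isUnit_iff_ne_zero]
      have : ((N + M + 1 : ℕ) : ℂ) * (1 * ζ⁻¹ ^ M) - ((M + 1 : ℕ) : ℂ) * ζ⁻¹ ^ M
          = N * ζ⁻¹ ^ M := by push_cast; ring
      rw [this]
      exact mul_ne_zero (Nat.cast_ne_zero.mpr hN.ne') (pow_ne_zero _ (inv_ne_zero hζ0)))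
  have hκ0 : PowerSeries.constantCoeff κ = ζ⁻¹ := by
    rw [hmem, map_sub, sub_eq_zero] at hκη
    simpa [η] using hκη
  have hκinv : κ * κ⁻¹ = 1 := PowerSeries.mul_inv_cancel κ (by rw [hκ0]; exact inv_ne_zero hζ0)
  refine ⟨κ⁻¹, by rw [PowerSeries.constantCoeff_inv, hκ0, inv_inv], ?_⟩
  have hTκ : T.eval κ = κ ^ (M + 1) * aeval (PowerSeries.X * κ⁻¹) u := by
    rw [hT, aeval_eq_sum_range, eval_finsetSum, Finset.mul_sum]
    refine Finset.sum_congr rfl fun i hi ↦ ?_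
    have hi' : i ≤ M := Nat.lt_succ_iff.mp (Finset.mem_range.mp hi)
    have hpow : κ ^ (M + 1) = κ ^ (M + 1 - i) * κ ^ i := by
      rw [← pow_add]; congr 1; omega
    have hone : κ ^ i * κ⁻¹ ^ i = 1 := by rw [← mul_pow, hκinv, one_pow]
    simp only [eval_mul, eval_C, eval_pow, eval_X]
    rw [PowerSeries.smul_eq_C_mul, hpow, mul_pow]
    linear_combination (-PowerSeries.C (u.coeff i) * PowerSeries.X ^ i * κ ^ (M + 1 - i)) * hone
  have hroot : κ ^ (N + M + 1) = U⁻¹ * T.eval κ := by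
    have : G.eval κ = 0 := hκ
    simp only [hG', eval_sub, eval_pow, eval_X, eval_mul, eval_C] at this
    exact sub_eq_zero.mp this
  have hκne : κ ^ (M + 1) ≠ 0 := by
    refine pow_ne_zero _ fun h ↦ ?_
    rw [h, zero_mul] at hκinv
    exact zero_ne_one hκinv
  have hN' : κ ^ N * U = aeval (PowerSeries.X * κ⁻¹) u := by
    apply mul_left_cancel₀ hκne
    rw [← hTκ]
    linear_combination U * hroot + T.eval κ * hUinv
  rw [← hN', ← mul_assoc, ← mul_pow, mul_comm κ⁻¹ κ, hκinv, one_pow, one_mul]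

/-- A polynomial lying in the subfield generated by a nonconstant polynomial `W` is a polynomial
in `W`. -/
lemma exists_eq_comp_of_mem_adjoin {p W : ℂ[X]} (hW : 0 < W.natDegree)
    (hp : algebraMap ℂ[X] (RatFunc ℂ) p ∈ ℂ⟮algebraMap ℂ[X] (RatFunc ℂ) W⟯) :
    ∃ p₁ : ℂ[X], p = p₁.comp W := by
  obtain ⟨r, s, hrs⟩ := (mem_adjoin_simple_iff _ _).mp hp
  have hae : ∀ P : ℂ[X], aeval (algebraMap ℂ[X] (RatFunc ℂ) W) P
      = algebraMap ℂ[X] (RatFunc ℂ) (P.comp W) := by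
    intro P
    rw [aeval_algebraMap_apply, comp_eq_aeval]
  by_cases hs : s = 0
  · refine ⟨0, ?_⟩
    rw [hs, map_zero, div_zero] at hrs
    simpa using hrs
  obtain ⟨r', s', D, hD, hrs', hr, hs'⟩ : ∃ r' s' D : ℂ[X], D ≠ 0 ∧ IsCoprime r' s' ∧
      r = D * r' ∧ s = D * s' := by
    classical
    have hg : EuclideanDomain.gcd r s ≠ 0 := fun h ↦ hs (EuclideanDomain.gcd_eq_zero_iff.mp h).2
    obtain ⟨r', hr'⟩ := EuclideanDomain.gcd_dvd_left r s
    obtain ⟨s', hs'⟩ := EuclideanDomain.gcd_dvd_right r s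
    refine ⟨r', s', _, hg, ?_, hr', hs'⟩
    refine ⟨EuclideanDomain.gcdA r s, EuclideanDomain.gcdB r s, ?_⟩
    apply mul_left_cancel₀ hg
    have := EuclideanDomain.gcd_eq_gcd_ab r s
    linear_combination (-EuclideanDomain.gcdA r s) * hr' -
      EuclideanDomain.gcdB r s * hs' - this
  have hcomp : ∀ P : ℂ[X], P ≠ 0 → P.comp W ≠ 0 := by
    intro P hP h0
    rcases comp_eq_zero_iff.mp h0 with h1 | ⟨-, h1⟩
    · exact hP h1
    · rw [h1, natDegree_C] at hW
      exact lt_irrefl _ hW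
  have hmul : p * s'.comp W = r'.comp W := by
    have hsW : algebraMap ℂ[X] (RatFunc ℂ) (s.comp W) ≠ 0 :=
      RatFunc.algebraMap_ne_zero (hcomp s hs)
    rw [hae, hae, eq_div_iff hsW, ← map_mul] at hrs
    have h1 := RatFunc.algebraMap_injective ℂ hrs
    rw [hr, hs', mul_comp, mul_comp] at h1
    apply mul_left_cancel₀ (hcomp D hD)
    linear_combination h1
  obtain ⟨a, b, hab⟩ := hrs'
  have hunit : IsUnit (s'.comp W) := by
    have h1 := congrArg (fun P : ℂ[X] ↦ P.comp W) hab
    simp only [add_comp, mul_comp, one_comp] at h1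
    refine IsUnit.of_mul_eq_one (a.comp W * p + b.comp W) ?_
    linear_combination h1 + a.comp W * hmul
  obtain ⟨c, hc, hc'⟩ := Polynomial.isUnit_iff.mp hunit
  refine ⟨C c⁻¹ * r', ?_⟩
  rw [mul_comp, C_comp, ← hmul, ← hc', mul_left_comm, ← C_mul, inv_mul_cancel₀ hc.ne_zero, C_1,
    mul_one]

/-- A subfield of `ℂ(X)` containing a nonconstant polynomial is generated by a polynomial. -/
lemma exists_eq_adjoin_polynomial {E : IntermediateField ℂ (RatFunc ℂ)} {p : ℂ[X]}
    (hp : 0 < p.natDegree) (hpE : algebraMap ℂ[X] (RatFunc ℂ) p ∈ E) :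
    ∃ W : ℂ[X], 0 < W.natDegree ∧ E = ℂ⟮algebraMap ℂ[X] (RatFunc ℂ) W⟯ := by
  have hE : E ≠ ⊥ := by
    rintro rfl
    obtain ⟨c, hc⟩ := mem_bot.mp hpE
    have h1 : p = C c := by
      apply RatFunc.algebraMap_injective ℂ
      rw [← hc, RatFunc.algebraMap_C]
      rfl
    rw [h1, natDegree_C] at hp
    exact lt_irrefl _ hp
  obtain ⟨i, hi⟩ : ∃ i, RatFunc.Luroth.generator E
      = (minpoly E (RatFunc.X : RatFunc ℂ)).coeff i := ⟨_, dif_neg hE⟩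
  have hp0 : p ≠ 0 := by rintro rfl; simp at hp
  let F : ℂ[X][X] := C (C p.leadingCoeff⁻¹) * (p.map C - C p)
  have hmonic : F.Monic := by
    have hlt : (C p : ℂ[X][X]).degree < (p.map C).degree := by
      rw [degree_map_eq_of_injective C_injective]
      exact degree_C_le.trans_lt (natDegree_pos_iff_degree_pos.mp hp)
    rw [Monic, leadingCoeff_mul, leadingCoeff_C, leadingCoeff_sub_of_degree_lt hlt,
      leadingCoeff_map_of_injective C_injective, ← C_mul,
      inv_mul_cancel₀ (leadingCoeff_ne_zero.mpr hp0), C_1]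
  let P : E[X] := p.map (algebraMap ℂ E) - C ⟨_, hpE⟩
  have hP : minpoly E (RatFunc.X : RatFunc ℂ) ∣ P := by
    apply minpoly.dvd
    have : aeval (RatFunc.X : RatFunc ℂ) p = algebraMap ℂ[X] (RatFunc ℂ) p := by
      rw [← RatFunc.algebraMap_X, aeval_algebraMap_apply, aeval_X_left_apply]
    simp [P, this]
  have hdvd : (minpoly E (RatFunc.X : RatFunc ℂ)).map (algebraMap E (RatFunc ℂ)) ∣
      F.map (algebraMap ℂ[X] (RatFunc ℂ)) := by
    have h1 : F.map (algebraMap ℂ[X] (RatFunc ℂ))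
        = C (algebraMap ℂ[X] (RatFunc ℂ) (C p.leadingCoeff⁻¹)) *
          P.map (algebraMap E (RatFunc ℂ)) := by
      simp only [F, P, Polynomial.map_mul, Polynomial.map_sub, map_C, Polynomial.map_map]
      rfl
    rw [h1]
    exact Dvd.dvd.mul_left (Polynomial.map_dvd _ hP) _
  have hmin : ((minpoly E (RatFunc.X : RatFunc ℂ)).map (algebraMap E (RatFunc ℂ))).Monic :=
    (minpoly.monic (RatFunc.IntermediateField.isAlgebraic_X hE).isIntegral).map _
  obtain ⟨Q, hQ⟩ := IsIntegrallyClosed.eq_map_mul_C_of_dvd (RatFunc ℂ) hmonic hdvd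
  rw [hmin.leadingCoeff, C_1, mul_one] at hQ
  have hgen : RatFunc.Luroth.generator E = algebraMap ℂ[X] (RatFunc ℂ) (Q.coeff i) := by
    rw [hi, ← coeff_map, hQ, coeff_map]
    rfl
  refine ⟨Q.coeff i, ?_, hgen ▸ RatFunc.Luroth.eq_adjoin_generator⟩
  rw [Nat.pos_iff_ne_zero]
  intro h0
  apply RatFunc.Luroth.generator_ne_C hE
  refine ⟨(Q.coeff i).coeff 0, ?_⟩
  rw [hgen, ← RatFunc.algebraMap_C, ← eq_C_of_natDegree_eq_zero h0]

/-- If `p` and `q` have no nontrivial common right factor, then `X` is a quotient of two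
polynomials in `p` and `q`. -/
lemma NoCommonRightFactor.exists_mul_X_eq {p q : ℂ[X]} (hp : 0 < p.natDegree)
    (hnc : NoCommonRightFactor p q) :
    ∃ r ∈ Algebra.adjoin ℂ {p, q}, ∃ s ∈ Algebra.adjoin ℂ {p, q}, s ≠ 0 ∧ s * X = r := by
  let φ : ℂ[X] →ₐ[ℂ] RatFunc ℂ := IsScalarTower.toAlgHom ℂ ℂ[X] (RatFunc ℂ)
  let E : IntermediateField ℂ (RatFunc ℂ) := adjoin ℂ (φ '' {p, q})
  have hpE : algebraMap ℂ[X] (RatFunc ℂ) p ∈ E := subset_adjoin _ _ ⟨p, by simp, rfl⟩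
  have hqE : algebraMap ℂ[X] (RatFunc ℂ) q ∈ E := subset_adjoin _ _ ⟨q, by simp, rfl⟩
  obtain ⟨W, hW, hEW⟩ := exists_eq_adjoin_polynomial hp hpE
  obtain ⟨p₁, hp₁⟩ := exists_eq_comp_of_mem_adjoin hW (hEW ▸ hpE)
  obtain ⟨q₁, hq₁⟩ := exists_eq_comp_of_mem_adjoin hW (hEW ▸ hqE)
  have hW1 : W.natDegree = 1 := le_antisymm (hnc p₁ q₁ W hp₁ hq₁) hW
  obtain ⟨a, ha, b, hab⟩ := natDegree_eq_one.mp hW1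
  have hWE : φ W ∈ E := by
    rw [hEW]
    exact mem_adjoin_simple_self _ _
  have hX : φ X ∈ E := by
    have h1 : X = C a⁻¹ * (W - C b) := by
      rw [← hab, add_sub_cancel_right, ← mul_assoc, ← C_mul, inv_mul_cancel₀ ha, C_1, one_mul]
    have hC : ∀ c : ℂ, φ (C c) ∈ E := fun c ↦ by
      have : φ (C c) = algebraMap ℂ (RatFunc ℂ) c := φ.commutes c
      rw [this]
      exact E.algebraMap_mem c
    rw [h1, map_mul, map_sub]
    exact E.mul_mem (hC _) (E.sub_mem hWE (hC _))
  obtain ⟨r, hr, s, hs, hrs⟩ := mem_adjoin_iff_div.mp hX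
  rw [← AlgHom.map_adjoin] at hr hs
  obtain ⟨r, hr, rfl⟩ := hr
  obtain ⟨s, hs, rfl⟩ := hs
  have hφ : Function.Injective φ := RatFunc.algebraMap_injective ℂ
  have hs0 : s ≠ 0 := by
    rintro rfl
    refine X_ne_zero (R := ℂ) (hφ ?_)
    rw [hrs]
    simp
  refine ⟨r, hr, s, hs, hs0, hφ ?_⟩
  have hsφ : φ s ≠ 0 := (map_ne_zero_iff φ hφ).mpr hs0
  rw [map_mul, hrs]
  exact mul_div_cancel₀ _ hsφ

lemma localDeg_pos {p : ℂ[X]} (hp : 0 < p.natDegree) (z : ℂ) : 0 < localDeg p z := by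
  have h0 : p - C (p.eval z) ≠ 0 := by
    intro h0
    rw [sub_eq_zero.mp h0, natDegree_C] at hp
    exact lt_irrefl _ hp
  rw [localDeg, rootMultiplicity_pos h0]
  simp

lemma exists_eq_C_add_pow_localDeg_mul {p : ℂ[X]} (hp : 0 < p.natDegree) (z : ℂ) :
    ∃ P : ℂ[X], P.eval z ≠ 0 ∧ p = C (p.eval z) + (X - C z) ^ localDeg p z * P := by
  have h0 : p - C (p.eval z) ≠ 0 := by
    intro h0
    rw [sub_eq_zero.mp h0, natDegree_C] at hp
    exact lt_irrefl _ hp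
  obtain ⟨P, hP, hPz⟩ := exists_eq_pow_rootMultiplicity_mul_and_not_dvd _ h0 z
  rw [dvd_iff_isRoot, IsRoot.def] at hPz
  exact ⟨P, hPz, by rw [localDeg, ← hP, add_sub_cancel]⟩

/-- Invariance of `f ∘ p` under a local substitution fixing `z` whose multiplier has order dividing
the local degree of `p` implies invariance of `p`. -/
lemma aeval_eq_of_aeval_comp_eq {f p : ℂ[X]} (hf : 0 < f.natDegree) (hp : 0 < p.natDegree)
    {z ζ : ℂ} (hζ : ζ ^ localDeg p z = 1) {ρ : PowerSeries ℂ}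
    (hρ : PowerSeries.constantCoeff ρ = ζ)
    (h : aeval (PowerSeries.C z + PowerSeries.X * ρ) (f.comp p)
      = aeval (PowerSeries.C z + PowerSeries.X * 1) (f.comp p)) :
    aeval (PowerSeries.C z + PowerSeries.X * ρ) p
      = aeval (PowerSeries.C z + PowerSeries.X * 1) p := by
  obtain ⟨P, hPz, hP⟩ := exists_eq_C_add_pow_localDeg_mul hp z
  have key : ∀ τ : PowerSeries ℂ, aeval (PowerSeries.C z + PowerSeries.X * τ) p
      = PowerSeries.C (p.eval z) + PowerSeries.X ^ localDeg p z *
        (τ ^ localDeg p z * aeval (PowerSeries.C z + PowerSeries.X * τ) P) := by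
    intro τ
    have h1 := congrArg (aeval (PowerSeries.C z + PowerSeries.X * τ)) hP
    have h2 : ∀ x : ℂ, algebraMap ℂ (PowerSeries ℂ) x = PowerSeries.C x := fun x ↦ rfl
    simp only [map_add, map_sub, map_mul, map_pow, aeval_X, aeval_C, h2] at h1
    rw [h1]
    ring
  refine eq_of_aeval_eq_of_leading_eq hf hPz (localDeg_pos hp z) (key ρ) (key 1) ?_ ?_ ?_
  · rw [map_mul, map_pow, hρ, hζ, one_mul, constantCoeff_aeval]
    simp
  · rw [map_mul, one_pow, map_one, one_mul, constantCoeff_aeval]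
    simp
  · simpa only [aeval_comp] using h

/-- For `ζ` of order dividing the local degree of `p` at `z`, there is a local substitution fixing
`z` with multiplier `ζ` that leaves `f ∘ p` invariant. -/
lemma exists_aeval_comp_eq {f p : ℂ[X]} (hf : 0 < f.natDegree) (hp : 0 < p.natDegree)
    {z ζ : ℂ} (hζ : ζ ^ localDeg p z = 1) :
    ∃ ρ : PowerSeries ℂ, PowerSeries.constantCoeff ρ = ζ ∧
      aeval (PowerSeries.C z + PowerSeries.X * ρ) (f.comp p)
        = aeval (PowerSeries.C z + PowerSeries.X * 1) (f.comp p) := by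
  obtain ⟨P, hPz, hP⟩ := exists_eq_C_add_pow_localDeg_mul hp z
  obtain ⟨F, hFz, hF⟩ := exists_eq_C_add_pow_localDeg_mul hf (p.eval z)
  set a := localDeg f (p.eval z)
  set e := localDeg p z
  let H : ℂ[X] := P ^ a * F.comp p
  have hfp : f.comp p = C (f.eval (p.eval z)) + (X - C z) ^ (e * a) * H := by
    conv_lhs => rw [hF]
    simp only [add_comp, C_comp, mul_comp, pow_comp, sub_comp, X_comp]
    have : p - C (p.eval z) = (X - C z) ^ e * P := sub_eq_of_eq_add' hP
    rw [this]
    ring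
  have hu : (H.comp (X + C z)).eval 0 ≠ 0 := by
    simp only [H, eval_comp, eval_add, eval_mul, eval_pow, eval_X, eval_C, zero_add]
    exact mul_ne_zero (pow_ne_zero _ hPz) hFz
  obtain ⟨ρ, hρ, hρu⟩ := exists_powerSeries_pow_mul_aeval_eq hu
    (Nat.mul_pos (localDeg_pos hp z) (localDeg_pos hf (p.eval z)))
    (show ζ ^ (e * a) = 1 by rw [pow_mul, hζ, one_pow])
  refine ⟨ρ, hρ, ?_⟩
  have h2 : ∀ x : ℂ, algebraMap ℂ (PowerSeries ℂ) x = PowerSeries.C x := fun x ↦ rfl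
  have h3 : ∀ τ : PowerSeries ℂ, aeval (PowerSeries.X * τ) (H.comp (X + C z))
      = aeval (PowerSeries.C z + PowerSeries.X * τ) H := by
    intro τ
    rw [aeval_comp, map_add, aeval_X, aeval_C, h2, add_comm]
  have h4 := h3 1
  rw [mul_one] at h4
  rw [h3, h4] at hρu
  rw [hfp]
  simp only [map_add, map_sub, map_mul, map_pow, aeval_X, aeval_C, h2, add_sub_cancel_left,
    mul_pow, mul_one]
  rw [mul_assoc, hρu]

theorem stmt_0 (f g p q : Polynomial ℂ)
    (hf : 0 < f.natDegree) (hg : 0 < g.natDegree)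
    (hp : 0 < p.natDegree) (hq : 0 < q.natDegree)
    (heq : f.comp p = g.comp q)
    (hirr : Irreducible (curvePoly f g))
    (hnc : NoCommonRightFactor p q) :
    ∀ z : ℂ, Nat.gcd (localDeg p z) (localDeg q z) = 1 := by
  intro z
  set d := Nat.gcd (localDeg p z) (localDeg q z)
  have hd : d ≠ 0 := (Nat.gcd_pos_of_pos_left _ (localDeg_pos hp z)).ne'
  have hprim := Complex.isPrimitiveRoot_exp d hd
  set ζ := Complex.exp (2 * Real.pi * Complex.I / d)
  have hζp : ζ ^ localDeg p z = 1 := (hprim.pow_eq_one_iff_dvd _).mpr (Nat.gcd_dvd_left _ _)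
  have hζq : ζ ^ localDeg q z = 1 := (hprim.pow_eq_one_iff_dvd _).mpr (Nat.gcd_dvd_right _ _)
  obtain ⟨ρ, hρ, hfp⟩ := exists_aeval_comp_eq hf hp hζp
  have hpρ := aeval_eq_of_aeval_comp_eq hf hp hζp hρ hfp
  have hqρ := aeval_eq_of_aeval_comp_eq hg hq hζq hρ (heq ▸ hfp)
  obtain ⟨r, hr, s, hs, hs0, hsr⟩ := hnc.exists_mul_X_eq hp
  have hagree : ∀ x ∈ Algebra.adjoin ℂ {p, q},
      aeval (PowerSeries.C z + PowerSeries.X * ρ) x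
        = aeval (PowerSeries.C z + PowerSeries.X * 1) x := by
    intro x hx
    refine AlgHom.adjoin_le_equalizer _ _ ?_ hx
    rintro y (rfl | rfl)
    · exact hpρ
    · exact hqρ
  have h1 := hagree r hr
  rw [← hsr, map_mul, map_mul, aeval_X, aeval_X, hagree s hs] at h1
  have hs1 : aeval (PowerSeries.C z + PowerSeries.X * 1) s ≠ 0 := by
    have h2 : aeval (PowerSeries.C z + PowerSeries.X * 1) s
        = ((s.comp (X + C z) : ℂ[X]) : PowerSeries ℂ) := by
      have : ∀ P : ℂ[X], (P : PowerSeries ℂ) = coeToPowerSeries.algHom ℂ P := fun P ↦ by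
        simp
      rw [this, comp_eq_aeval, ← aeval_algHom_apply, map_add, ← this, ← this, mul_one, coe_X,
        coe_C, add_comm]
    rw [h2, Ne, Polynomial.coe_eq_zero_iff, comp_eq_zero_iff]
    rintro (h3 | ⟨-, h3⟩)
    · exact hs0 h3
    · have := congrArg natDegree h3
      rw [natDegree_X_add_C, natDegree_C] at this
      exact one_ne_zero this
  have h3 := mul_left_cancel₀ PowerSeries.X_ne_zero (add_left_cancel (mul_left_cancel₀ hs1 h1))
  rw [h3, map_one] at hρ
  exact Nat.dvd_one.mp ((hprim.pow_eq_one_iff_dvd 1).mp (by rw [pow_one, ← hρ]))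
end

section
/- Let f, g, p, q be nonconstant polynomials over ℂ such that f ∘ p = g ∘ q, the bivariate polynomial f(X) − g(Y) is irreducible in ℂ[X,Y], and p and q have no nontrivial common right compositional factor. Then deg f = deg q and deg g = deg p. -/
open Polynomial

namespace RatFunc

open _root_.IntermediateField WithZero

variable {K : Type*} [Field K]

theorem adjoin_simple_inv (w : RatFunc K) : K⟮w⁻¹⟯ = K⟮w⟯ := by
  apply le_antisymm <;> rw [adjoin_simple_le_iff]
  · exact inv_mem (mem_adjoin_simple_self K w)
  · simpa using inv_mem (mem_adjoin_simple_self K w⁻¹)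

theorem adjoin_simple_sub_C (w : RatFunc K) (c : K) : K⟮w - C c⟯ = K⟮w⟯ := by
  have hC (E : IntermediateField K (RatFunc K)) : C c ∈ E := E.algebraMap_mem c
  apply le_antisymm <;> rw [adjoin_simple_le_iff]
  · exact sub_mem (mem_adjoin_simple_self K w) (hC _)
  · simpa using add_mem (mem_adjoin_simple_self K (w - C c)) (hC _)

section InftyValuation

variable [DecidableEq (RatFunc K)]

theorem inftyValuation_algebraMap {p : K[X]} (hp : p ≠ 0) :
    inftyValuation K (algebraMap K[X] (RatFunc K) p) = exp (p.natDegree : ℤ) :=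
  inftyValuation.polynomial K hp

theorem one_lt_inftyValuation_algebraMap {p : K[X]} (hp : 0 < p.natDegree) :
    1 < inftyValuation K (algebraMap K[X] (RatFunc K) p) := by
  rw [inftyValuation_algebraMap (ne_zero_of_natDegree_gt hp), ← exp_zero, exp_lt_exp]
  exact_mod_cast hp

/-- A rational function which is a unit at infinity differs from a constant by a function
vanishing at infinity. -/
theorem exists_inftyValuation_sub_C_lt_one {w : RatFunc K} (hw : inftyValuation K w = 1) :
    ∃ c, inftyValuation K (w - C c) < 1 := by
  have hw0 : w ≠ 0 := by rintro rfl; simp at hw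
  have hnum := num_ne_zero hw0
  have hden := w.denom_ne_zero
  have hval := inftyValuation_algebraMap hden
  have hdeg : w.num.natDegree = w.denom.natDegree := by
    have h : w.intDegree = 0 := by
      rw [inftyValuation_apply, inftyValuation_of_nonzero K hw0, ← exp_zero, exp_inj] at hw
      exact hw
    rw [intDegree] at h
    omega
  refine ⟨w.num.leadingCoeff, ?_⟩
  have hmul : (w - C w.num.leadingCoeff) * algebraMap K[X] (RatFunc K) w.denom =
      algebraMap K[X] (RatFunc K) (w.num - Polynomial.C w.num.leadingCoeff * w.denom) := by
    rw [sub_mul, map_sub, map_mul, algebraMap_C]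
    congr 1
    nth_rw 1 [← num_div_denom w]
    exact div_mul_cancel₀ _ (algebraMap_ne_zero hden)
  have hv := congrArg (inftyValuation K) hmul
  rw [map_mul, hval] at hv
  by_contra! hge
  have hle := mul_le_mul_left hge (exp (w.denom.natDegree : ℤ))
  rw [one_mul, hv] at hle
  have hne : w.num - Polynomial.C w.num.leadingCoeff * w.denom ≠ 0 := by
    intro h
    simp [h] at hle
  rw [inftyValuation_algebraMap hne, exp_le_exp] at hle
  have hlt : (w.num - Polynomial.C w.num.leadingCoeff * w.denom).degree < w.num.degree := by
    have hlc : w.num.leadingCoeff ≠ 0 := leadingCoeff_ne_zero.mpr hnum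
    apply degree_sub_lt_left _ hnum
    · simp [leadingCoeff_mul, (monic_denom w).leadingCoeff]
    · rw [degree_C_mul hlc, degree_eq_natDegree hnum, degree_eq_natDegree hden, hdeg]
  have := natDegree_lt_natDegree hne hlt
  omega

/-- A refinement of Lüroth's theorem: the generator can be chosen with a pole at infinity. -/
theorem exists_eq_adjoin_one_lt_inftyValuation {E : IntermediateField K (RatFunc K)}
    (hE : E ≠ ⊥) : ∃ w, E = K⟮w⟯ ∧ 1 < inftyValuation K w := by
  have small (w : RatFunc K) (hEw : E = K⟮w⟯) (hw : inftyValuation K w < 1) :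
      ∃ w, E = K⟮w⟯ ∧ 1 < inftyValuation K w := by
    refine ⟨w⁻¹, hEw.trans (adjoin_simple_inv w).symm, ?_⟩
    have hw0 : w ≠ 0 := by
      rintro rfl
      exact hE (hEw.trans adjoin_zero)
    rw [map_inv₀]
    exact (one_lt_inv₀ (zero_lt_iff.mpr ((Valuation.ne_zero_iff _).mpr hw0))).mpr hw
  have hgen := Luroth.eq_adjoin_generator (E := E)
  rcases lt_trichotomy (inftyValuation K (Luroth.generator E)) 1 with h | h | h
  · exact small _ hgen h
  · obtain ⟨c, hc⟩ := exists_inftyValuation_sub_C_lt_one h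
    exact small _ (hgen.trans (adjoin_simple_sub_C _ c).symm) hc
  · exact ⟨_, hgen, h⟩

/-- If a nonconstant polynomial is a rational function of `w` and `w` has a pole at infinity,
then `w` is a polynomial. -/
theorem exists_algebraMap_eq_of_mem_adjoin {w : RatFunc K} (hw : 1 < inftyValuation K w)
    {p : K[X]} (hp : 0 < p.natDegree) (hmem : algebraMap K[X] (RatFunc K) p ∈ K⟮w⟯) :
    ∃ W : K[X], algebraMap K[X] (RatFunc K) W = w := by
  obtain ⟨A, B, hAB⟩ := (mem_adjoin_simple_iff K _).mp hmem
  have hp0 : algebraMap K[X] (RatFunc K) p ≠ 0 :=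
    algebraMap_ne_zero (ne_zero_of_natDegree_gt hp)
  have hBw : aeval w B ≠ 0 := by
    intro h
    simp [h] at hAB
    simp [hAB] at hp
  have hAw : aeval w A ≠ 0 := by
    intro h
    simp [h] at hAB
    simp [hAB] at hp
  have hA : A ≠ 0 := by rintro rfl; simp at hAw
  have hB : B ≠ 0 := by rintro rfl; simp at hBw
  rw [eq_div_iff hBw] at hAB
  have hdeg : B.natDegree < A.natDegree := by
    have hv := congrArg (inftyValuation K) hAB
    rw [map_mul, valuation_aeval_eq_valuation_X_pow_natDegree_of_one_lt_valuation_X w hw hA,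
      valuation_aeval_eq_valuation_X_pow_natDegree_of_one_lt_valuation_X w hw hB] at hv
    rw [← pow_lt_pow_iff_right₀ hw, ← hv]
    exact lt_mul_of_one_lt_left (pow_pos (zero_lt_one.trans hw) _)
      (one_lt_inftyValuation_algebraMap hp)
  have hlc : A.leadingCoeff ≠ 0 := leadingCoeff_ne_zero.mpr hA
  have hint : IsIntegral K[X] w := by
    refine ⟨Polynomial.C (Polynomial.C A.leadingCoeff⁻¹) *
      (A.map Polynomial.C - Polynomial.C p * B.map Polynomial.C), ?_, ?_⟩
    · have hlt : (Polynomial.C p * B.map Polynomial.C).degree < (A.map Polynomial.C).degree := by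
        apply degree_lt_degree
        rw [natDegree_C_mul (ne_zero_of_natDegree_gt hp), natDegree_map, natDegree_map]
        exact hdeg
      rw [Monic, leadingCoeff_mul, leadingCoeff_sub_of_degree_lt hlt,
        leadingCoeff_map_of_injective Polynomial.C_injective, leadingCoeff_C, ← map_mul,
        inv_mul_cancel₀ hlc, map_one]
    · have hcomp : (algebraMap K[X] (RatFunc K)).comp Polynomial.C = algebraMap K (RatFunc K) := by
        ext; simp
      rw [eval₂_mul, eval₂_sub, eval₂_mul, eval₂_C, eval₂_C, eval₂_map, eval₂_map, hcomp]
      simp only [aeval_def] at hAB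
      rw [hAB, sub_self, mul_zero]
  exact IsIntegrallyClosed.isIntegral_iff.mp hint

end InftyValuation

/-- A polynomial which is a rational function of a nonconstant polynomial `W` is a polynomial
in `W`. -/
theorem exists_eq_comp_of_mem_adjoin {W p : K[X]} (hW : 0 < W.natDegree)
    (hmem : algebraMap K[X] (RatFunc K) p ∈ K⟮algebraMap K[X] (RatFunc K) W⟯) :
    ∃ A : K[X], p = A.comp W := by
  obtain ⟨A, B, hAB⟩ := (mem_adjoin_simple_iff K _).mp hmem
  simp only [aeval_algebraMap_apply, ← comp_eq_aeval] at hAB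
  by_cases hBW : B.comp W = 0
  · refine ⟨0, algebraMap_injective K ?_⟩
    simpa [hBW] using hAB
  rw [eq_div_iff (algebraMap_ne_zero hBW), ← map_mul] at hAB
  replace hAB := algebraMap_injective K hAB
  have hB : B ≠ 0 := by rintro rfl; simp at hBW
  refine ⟨A / B, ?_⟩
  have hrem : (p - (A / B).comp W) * B.comp W = (A % B).comp W := by
    have := congrArg (fun F => F.comp W) (EuclideanDomain.div_add_mod A B)
    simp only [add_comp, mul_comp] at this
    rw [sub_mul, hAB, ← this]
    ring
  by_contra hne
  have hne' := sub_ne_zero.mpr hne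
  have hmod : A % B ≠ 0 := by
    intro h
    rw [h, zero_comp] at hrem
    exact mul_ne_zero hne' hBW hrem
  have hlt : (A % B).natDegree < B.natDegree :=
    natDegree_lt_natDegree hmod (EuclideanDomain.mod_lt A hB)
  have hdeg := congrArg natDegree hrem
  rw [natDegree_mul hne' hBW, natDegree_comp, natDegree_comp] at hdeg
  have := Nat.mul_lt_mul_of_pos_right hlt hW
  omega

/-- Lüroth's theorem for fields containing a nonconstant polynomial. -/
theorem exists_eq_adjoin_algebraMap {E : IntermediateField K (RatFunc K)} {p : K[X]}
    (hp : 0 < p.natDegree) (hmem : algebraMap K[X] (RatFunc K) p ∈ E) :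
    ∃ W : K[X], 0 < W.natDegree ∧ E = K⟮algebraMap K[X] (RatFunc K) W⟯ := by
  classical
  have hE : E ≠ ⊥ := by
    rintro rfl
    obtain ⟨c, hc⟩ := IntermediateField.mem_bot.mp hmem
    have : Polynomial.C c = p := algebraMap_injective K (by rw [← hc, algebraMap_C]; rfl)
    simp [← this] at hp
  obtain ⟨w, rfl, hw⟩ := exists_eq_adjoin_one_lt_inftyValuation hE
  obtain ⟨W, rfl⟩ := exists_algebraMap_eq_of_mem_adjoin hw hp hmem
  refine ⟨W, ?_, rfl⟩
  by_contra! h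
  rw [eq_C_of_natDegree_eq_zero (Nat.le_zero.mp h)] at hE
  refine hE (adjoin_simple_eq_bot_iff.mpr (IntermediateField.mem_bot.mpr ⟨W.coeff 0, ?_⟩))
  rw [algebraMap_C]
  rfl

theorem finrank_adjoin_algebraMap (p : K[X]) :
    Module.finrank K⟮algebraMap K[X] (RatFunc K) p⟯ (RatFunc K) = p.natDegree := by
  simp [finrank_eq_max_natDegree]

/-- If `p` is nonconstant and `P` is an irreducible polynomial in two variables of positive degree
in the second variable, then `P(p, Y)` is irreducible over `K(p)`. -/
theorem irreducible_map_aeval {p : K[X]} (hp : 0 < p.natDegree) {P : K[X][X]}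
    (hirr : Irreducible P) (hdeg : P.natDegree ≠ 0) :
    Irreducible (P.map (aeval (AdjoinSimple.gen K (algebraMap K[X] (RatFunc K) p))).toRingHom) := by
  classical
  set x := algebraMap K[X] (RatFunc K) p with hx
  have htr : Transcendental K x := by
    refine Valuation.transcendental_of_ne_one (v := inftyValuation K) K x
      (algebraMap_ne_zero (ne_zero_of_natDegree_gt hp))
      (one_lt_inftyValuation_algebraMap hp).ne'
  have hmap := (IsPrimitive.irreducible_iff_irreducible_map_fraction_map (K := RatFunc K)
    (hirr.isPrimitive hdeg)).mp hirr
  have he : (aeval (AdjoinSimple.gen K x)).toRingHom =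
      (algEquivOfTranscendental x htr).toRingEquiv.toRingHom.comp
        (algebraMap K[X] (RatFunc K)) := by
    refine RingHom.ext fun g => ?_
    exact (algEquivOfTranscendental_algebraMap x htr g).symm
  rw [he, ← Polynomial.map_map]
  exact (MulEquiv.irreducible_iff
    (mapEquiv (algEquivOfTranscendental x htr).toRingEquiv)).mpr hmap

end RatFunc

open IntermediateField

theorem stmt_1 (f g p q : Polynomial ℂ)
    (hf : 0 < f.natDegree) (hg : 0 < g.natDegree)
    (hp : 0 < p.natDegree) (hq : 0 < q.natDegree)
    (heq : f.comp p = g.comp q)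
    (hirr : Irreducible (curvePoly f g))
    (hnc : NoCommonRightFactor p q) :
    f.natDegree = q.natDegree ∧ g.natDegree = p.natDegree := by
  set P := algebraMap ℂ[X] (RatFunc ℂ) p with hP
  set Q := algebraMap ℂ[X] (RatFunc ℂ) q with hQ
  have hPmem : P ∈ ℂ⟮P, Q⟯ := subset_adjoin _ _ (by simp)
  have hQmem : Q ∈ ℂ⟮P, Q⟯ := subset_adjoin _ _ (by simp)
  obtain ⟨W, hW, hEW⟩ := RatFunc.exists_eq_adjoin_algebraMap hp hPmem
  rw [hEW] at hPmem hQmem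
  obtain ⟨p₁, hp₁⟩ := RatFunc.exists_eq_comp_of_mem_adjoin hW hPmem
  obtain ⟨q₁, hq₁⟩ := RatFunc.exists_eq_comp_of_mem_adjoin hW hQmem
  have hW1 : W.natDegree = 1 := le_antisymm (hnc p₁ q₁ W hp₁ hq₁) hW
  have htop : ℂ⟮P, Q⟯ = ⊤ := by
    rw [hEW, ← finrank_eq_one_iff_eq_top, RatFunc.finrank_adjoin_algebraMap, hW1]
  have htop' : ℂ⟮P⟯⟮Q⟯ = ⊤ := by
    rw [← restrictScalars_eq_top_iff (K := ℂ), adjoin_simple_adjoin_simple, htop]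
  have hcdeg : (curvePoly f g).natDegree = g.natDegree := by
    rw [curvePoly, natDegree_sub, natDegree_sub_C, natDegree_map_eq_of_injective C_injective]
  have hirr' := RatFunc.irreducible_map_aeval hp hirr (hcdeg.trans_ne hg.ne')
  set R := (curvePoly f g).map (aeval (AdjoinSimple.gen ℂ P)).toRingHom with hR
  have hReq : R = C (aeval (AdjoinSimple.gen ℂ P) f) - g.map (algebraMap ℂ ℂ⟮P⟯) := by
    rw [hR, curvePoly, Polynomial.map_sub, map_C, Polynomial.map_map]
    congr 2
    exact RingHom.ext fun c => aeval_C _ c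
  have hRdeg : R.natDegree = g.natDegree := by
    rw [hReq, natDegree_sub, natDegree_sub_C, natDegree_map]
  have hroot : aeval Q R = 0 := by
    rw [hReq, map_sub, aeval_C, aeval_map_algebraMap, ← aeval_algebraMap_apply,
      AdjoinSimple.algebraMap_gen, hP, hQ, aeval_algebraMap_apply, aeval_algebraMap_apply,
      ← comp_eq_aeval, ← comp_eq_aeval, heq, sub_self]
  have hmin : (minpoly ℂ⟮P⟯ Q).natDegree = R.natDegree := by
    rw [← minpoly.eq_of_irreducible hirr' hroot, mul_comm, natDegree_C_mul]
    exact inv_ne_zero (leadingCoeff_ne_zero.mpr hirr'.ne_zero)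
  have hint : IsIntegral ℂ⟮P⟯ Q := isAlgebraic_iff_isIntegral.mp ⟨R, hirr'.ne_zero, hroot⟩
  have hfin := adjoin.finrank hint
  rw [htop', finrank_top', RatFunc.finrank_adjoin_algebraMap, hmin, hRdeg] at hfin
  refine ⟨?_, hfin.symm⟩
  have hdeg := congrArg natDegree heq
  rw [natDegree_comp, natDegree_comp, ← hfin, mul_comm] at hdeg
  exact Nat.eq_of_mul_eq_mul_left hp hdeg
end

section
/- Let f, g, p, q be nonconstant polynomials over ℂ such that f ∘ p = g ∘ q, the bivariate polynomial f(X) − g(Y) is irreducible in ℂ[X,Y], and deg f = deg q and deg g = deg p. Then p and q have no nontrivial common right compositional factor. -/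
open Polynomial

/-- If `A` is generated over an integrally closed domain `R` by a root of a monic polynomial `h`,
then an irreducible polynomial over `R` having a root in `A` has degree at most
that of `h`. -/
theorem natDegree_le_of_irreducible_of_eval₂_eq_zero {R A : Type*} [CommRing R] [IsDomain R]
    [IsIntegrallyClosed R] [CommRing A] [IsDomain A] (φ : R →+* A) (hφ : Function.Injective φ)
    {x y : A} {h F : R[X]} (hx : ∀ a, ∃ P : R[X], P.eval₂ φ x = a) (hh : h.Monic)
    (hhx : h.eval₂ φ x = 0) (hF : Irreducible F) (hFy : F.eval₂ φ y = 0) :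
    F.natDegree ≤ h.natDegree := by
  classical
  let _ := φ.toAlgebra
  have : FaithfulSMul R A := (faithfulSMul_iff_algebraMap_injective R A).2 hφ
  have hspan : Submodule.span R (((Finset.range h.natDegree).image (x ^ ·) : Finset A) : Set A) =
      ⊤ := by
    rw [Submodule.span_range_natDegree_eq_adjoin hh hhx, Algebra.toSubmodule_eq_top, eq_top_iff]
    rintro a -
    obtain ⟨P, rfl⟩ := hx a
    exact aeval_mem_adjoin_singleton R x
  have : Module.Finite R A := ⟨_, hspan⟩
  have hy : IsIntegral R y := IsIntegral.of_finite R y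
  have hrank : (⊤ : Submodule R A).spanFinrank ≤ h.natDegree := by
    rw [← hspan]
    refine (Submodule.spanFinrank_span_le_ncard_of_finite (Finset.finite_toSet _)).trans ?_
    rw [Set.ncard_coe_finset]
    exact Finset.card_image_le.trans (Finset.card_range _).le
  have hdvd : F ∣ minpoly R y :=
    (minpoly.prime_of_isIntegrallyClosed hy).irreducible.dvd_symm hF (minpoly.isIntegrallyClosed_dvd hy hFy)
  exact (natDegree_le_of_dvd hdvd (minpoly.ne_zero hy)).trans
    ((minpoly.natDegree_le_spanFinrank R y).trans hrank)

theorem eval₂_curvePoly (f g p q : Polynomial ℂ) :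
    (curvePoly f g).eval₂ (compRingHom p) q = f.comp p - g.comp q := by
  have hC : (compRingHom p).comp C = (C : ℂ →+* ℂ[X]) := by ext; simp
  rw [curvePoly, eval₂_sub, eval₂_C, eval₂_map, hC]
  simp [comp]

theorem natDegree_curvePoly (f g : Polynomial ℂ) : (curvePoly f g).natDegree = g.natDegree := by
  rw [curvePoly, natDegree_sub, natDegree_sub_C, natDegree_map_eq_of_injective C_injective]

/-- A polynomial parametrization `(p, q)` of the irreducible curve `f(x) = g(y)` satisfies
`deg g ≤ deg p`. -/
theorem natDegree_le_of_irreducible_curvePoly {f g p q : Polynomial ℂ} (hp : 0 < p.natDegree)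
    (hirr : Irreducible (curvePoly f g)) (heq : f.comp p = g.comp q) :
    g.natDegree ≤ p.natDegree := by
  have hinj : Function.Injective (compRingHom p : ℂ[X] →+* ℂ[X]) := by
    rw [injective_iff_map_eq_zero]
    intro a ha
    rcases comp_eq_zero_iff.1 ha with h | ⟨-, h⟩
    · exact h
    · rw [h, natDegree_C] at hp
      exact absurd hp (lt_irrefl 0)
  have hp0 : p ≠ 0 := ne_zero_of_natDegree_gt hp
  have hC : (compRingHom p).comp C = (C : ℂ →+* ℂ[X]) := by ext; simp
  set u : ℂ := p.leadingCoeff⁻¹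
  have hmonic : (C u * p).Monic := by
    rw [Monic, leadingCoeff_mul, leadingCoeff_C]
    exact inv_mul_cancel₀ (leadingCoeff_ne_zero.2 hp0)
  have hdeg : ((C u * p).map (C : ℂ →+* ℂ[X])).natDegree = p.natDegree := by
    rw [hmonic.natDegree_map, natDegree_C_mul (inv_ne_zero (leadingCoeff_ne_zero.2 hp0))]
  have hroot : ((C u * p).map C - C (C u * X)).eval₂ (compRingHom p) X = 0 := by
    rw [eval₂_sub, eval₂_map, hC, eval₂_C]
    simp
  rw [← natDegree_curvePoly f g, ← hdeg,
    ← natDegree_sub_C (p := (C u * p).map C) (a := C u * X)]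
  refine natDegree_le_of_irreducible_of_eval₂_eq_zero (compRingHom p) hinj (x := X) (y := q)
    (fun a => ⟨a.map C, ?_⟩) ?_ hroot hirr ?_
  · rw [eval₂_map, hC, eval₂_C_X]
  · refine (hmonic.map C).sub_of_left (degree_C_le.trans_lt ?_)
    rw [← natDegree_pos_iff_degree_pos, hdeg]
    exact hp
  · rw [eval₂_curvePoly, heq, sub_self]

theorem stmt_2 (f g p q : Polynomial ℂ)
    (hf : 0 < f.natDegree) (hg : 0 < g.natDegree)
    (hp : 0 < p.natDegree) (hq : 0 < q.natDegree)
    (heq : f.comp p = g.comp q)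
    (hirr : Irreducible (curvePoly f g))
    (hdeg : f.natDegree = q.natDegree ∧ g.natDegree = p.natDegree) :
    NoCommonRightFactor p q := by
  rintro p₁ q₁ W rfl rfl
  rw [natDegree_comp] at hp
  have hW : 0 < W.natDegree := Nat.pos_of_mul_pos_left hp
  have hp₁ : 0 < p₁.natDegree := Nat.pos_of_mul_pos_right hp
  have heq₁ : f.comp p₁ = g.comp q₁ := by
    rw [← comp_assoc, ← comp_assoc, ← sub_eq_zero, ← sub_comp, comp_eq_zero_iff] at heq
    rcases heq with h | ⟨-, h⟩
    · exact sub_eq_zero.1 h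
    · rw [h, natDegree_C] at hW
      exact absurd hW (lt_irrefl 0)
  have hle := natDegree_le_of_irreducible_curvePoly hp₁ hirr heq₁
  rw [hdeg.2, natDegree_comp] at hle
  exact Nat.le_of_mul_le_mul_left (by simpa using hle) hp₁
end

section
/- Let f, g, p, q be nonconstant polynomials over ℂ such that f ∘ p = g ∘ q, p and q have no nontrivial common right compositional factor, and deg f = deg q and deg g = deg p. Then the bivariate polynomial f(X) − g(Y) is irreducible in ℂ[X,Y]. -/
open Polynomial

section
variable {k : Type*} [Field k]

/-- The substitution `T ↦ T * t` on `k[t][T]`, with values in `k[T][t]`. The `t`-degree of the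
image is the total degree. -/
noncomputable def totalDegreeHom : k[X][X] →+* k[X][X] :=
  eval₂RingHom (mapRingHom C) (C X * X)

theorem coeff_coeff_totalDegreeHom (F : k[X][X]) (m i : ℕ) :
    ((totalDegreeHom F).coeff m).coeff i = if i ≤ m then (F.coeff i).coeff (m - i) else 0 := by
  induction F using Polynomial.induction_on' with
  | add F G hF hG =>
    rw [map_add, coeff_add, coeff_add, hF, hG]
    split_ifs <;> simp
  | monomial j a =>
    have : totalDegreeHom (monomial j a) = C (X ^ j) * (a.map C * X ^ j) := by
      simp [totalDegreeHom, eval₂_monomial]; ring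
    rw [this, coeff_C_mul, coeff_mul_X_pow', coeff_monomial]
    split_ifs <;> simp_all [coeff_X_pow] <;> grind

theorem natDegree_coeff_add_le_of_dvd_sub {p : k[X]} (hp : p.Monic) (hp0 : 0 < p.natDegree)
    {F : k[X][X]} (hF : F.Monic) (hdvd : F ∣ p.map C - C p) (i : ℕ) (hi : F.coeff i ≠ 0) :
    (F.coeff i).natDegree + i ≤ F.natDegree := by
  obtain ⟨G, hG⟩ := hdvd
  set n := p.natDegree with hn
  have hmonic : (p.map C - C p : k[X][X]).Monic :=
    (hp.map C).sub_of_left (by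
      rw [degree_map, degree_eq_natDegree hp.ne_zero]
      exact degree_C_le.trans_lt (by exact_mod_cast hp0))
  have hdegS : (p.map C - C p : k[X][X]).natDegree = n := by
    rw [natDegree_sub_C, natDegree_map]
  have hGm : G.Monic := hF.of_mul_monic_left (hG ▸ hmonic)
  have hsum : F.natDegree + G.natDegree = n := by
    rw [← hF.natDegree_mul hGm, ← hG, hdegS]
  have hcoeff (m : ℕ) : (totalDegreeHom (p.map C - C p)).coeff m = C (p.coeff m) * (X ^ m - 1) := by
    ext j
    rw [coeff_coeff_totalDegreeHom, coeff_C_mul, coeff_sub, coeff_sub, coeff_sub,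
      coeff_map, coeff_C, coeff_X_pow, coeff_one, coeff_C]
    rcases eq_or_ne j m with rfl | hjm
    · by_cases hj : j = 0 <;> simp [hj]
    · by_cases hj : j = 0
      · subst hj; simp [hjm]; omega
      · simp only [hj, hjm]; simp; omega
  have hX : (X ^ n - 1 : k[X]).natDegree = n := by
    simpa using natDegree_X_pow_sub_C (R := k) (n := n) (r := 1)
  have hX0 : (X ^ n - 1 : k[X]) ≠ 0 := fun h => by simp [h] at hX; omega
  have hcn : (totalDegreeHom (p.map C - C p)).coeff n = X ^ n - 1 := by
    rw [hcoeff, hn, hp.coeff_natDegree]; simp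
  have hdeg : (totalDegreeHom (p.map C - C p)).natDegree = n := by
    refine natDegree_eq_of_le_of_coeff_ne_zero ?_ (hcn ▸ hX0)
    refine natDegree_le_iff_coeff_eq_zero.2 fun m hm => ?_
    rw [hcoeff, coeff_eq_zero_of_natDegree_lt hm]; simp
  have hlead : (totalDegreeHom F).leadingCoeff * (totalDegreeHom G).leadingCoeff = X ^ n - 1 := by
    rw [← leadingCoeff_mul, ← map_mul, ← hG, leadingCoeff, hdeg, hcn]
  have hle (H : k[X][X]) (m : ℕ) : ((totalDegreeHom H).coeff m).natDegree ≤ H.natDegree := by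
    refine natDegree_le_iff_coeff_eq_zero.2 fun j hj => ?_
    rw [coeff_coeff_totalDegreeHom, coeff_eq_zero_of_natDegree_lt hj]; simp
  have hF0 : (totalDegreeHom F).leadingCoeff ≠ 0 := left_ne_zero_of_mul (hlead ▸ hX0)
  have hG0 : (totalDegreeHom G).leadingCoeff ≠ 0 := right_ne_zero_of_mul (hlead ▸ hX0)
  have hadd := natDegree_mul hF0 hG0
  rw [hlead, hX] at hadd
  have hlF : (totalDegreeHom F).leadingCoeff.natDegree = F.natDegree := by
    have h1 := hle F (totalDegreeHom F).natDegree
    have h2 := hle G (totalDegreeHom G).natDegree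
    rw [coeff_natDegree] at h1 h2
    omega
  have hD : (totalDegreeHom F).natDegree ≤ F.natDegree := by
    have h1 : (totalDegreeHom F).leadingCoeff.coeff F.natDegree ≠ 0 := by
      rw [← hlF, coeff_natDegree]; exact leadingCoeff_ne_zero.2 hF0
    rw [leadingCoeff, coeff_coeff_totalDegreeHom, hF.coeff_natDegree, coeff_one] at h1
    by_contra h
    exact h1 (by split_ifs <;> first | rfl | omega)
  refine le_trans (le_natDegree_of_ne_zero fun h => ?_) hD
  have := coeff_coeff_totalDegreeHom F ((F.coeff i).natDegree + i) i
  simp [h] at this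
  exact hi (leadingCoeff_eq_zero.1 this.symm)

theorem exists_sum_comp_mul_X_pow {W : k[X]} (hW : 0 < W.natDegree) (P : k[X]) :
    ∃ c : ℕ → k[X], P = ∑ j ∈ Finset.range W.natDegree, (c j).comp W * X ^ j := by
  induction hn : P.natDegree using Nat.strong_induction_on generalizing P with
  | _ n ih =>
    by_cases hlt : P.natDegree < W.natDegree
    · refine ⟨fun j => C (P.coeff j), ?_⟩
      simpa using P.as_sum_range_C_mul_X_pow' hlt
    · have hmod : (P % W).natDegree < W.natDegree := natDegree_mod_lt P hW.ne'
      have hdiv : (P / W).natDegree < n := by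
        rcases eq_or_ne (P / W) 0 with h0 | h0
        · rw [h0, natDegree_zero]; omega
        · exact hn ▸ natDegree_lt_natDegree h0
            (degree_div_lt (fun h => h0 (by simp [h])) (natDegree_pos_iff_degree_pos.1 hW))
      obtain ⟨c, hc⟩ := ih _ hdiv (P / W) rfl
      refine ⟨fun j => X * c j + C ((P % W).coeff j), ?_⟩
      conv_lhs => rw [← EuclideanDomain.div_add_mod P W, hc, (P % W).as_sum_range_C_mul_X_pow' hmod]
      simp [add_mul, Finset.sum_add_distrib, Finset.mul_sum, mul_assoc]

theorem isIntegral_ratFuncX_of_monic_mem {E : IntermediateField k (RatFunc k)} {p : k[X]}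
    (hp : p.Monic) (hp0 : 0 < p.natDegree) (hpE : algebraMap k[X] (RatFunc k) p ∈ E) :
    IsIntegral E (RatFunc.X : RatFunc k) := by
  refine ⟨p.map (algebraMap k E) - C (⟨_, hpE⟩ : E), (hp.map _).sub_of_left ?_, ?_⟩
  · rw [degree_map, degree_eq_natDegree hp.ne_zero]
    exact degree_C_le.trans_lt (by exact_mod_cast hp0)
  · rw [← aeval_def, map_sub, aeval_map_algebraMap, aeval_C]
    simp [← RatFunc.algebraMap_X, aeval_algebraMap_apply]

theorem exists_mem_natDegree_le_natDegree_minpoly {E : IntermediateField k (RatFunc k)} {p : k[X]}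
    (hp : p.Monic) (hp0 : 0 < p.natDegree) (hpE : algebraMap k[X] (RatFunc k) p ∈ E) :
    ∃ W : k[X], 0 < W.natDegree ∧ algebraMap k[X] (RatFunc k) W ∈ E ∧
      W.natDegree ≤ (minpoly E (RatFunc.X : RatFunc k)).natDegree := by
  have hint := isIntegral_ratFuncX_of_monic_mem hp hp0 hpE
  set φ := minpoly E (RatFunc.X : RatFunc k)
  have hφm : φ.Monic := minpoly.monic hint
  set S : k[X][X] := p.map C - C p with hS
  have hSm : S.Monic :=
    (hp.map C).sub_of_left (by
      rw [degree_map, degree_eq_natDegree hp.ne_zero]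
      exact degree_C_le.trans_lt (by exact_mod_cast hp0))
  have hSmap : S.map (algebraMap k[X] (RatFunc k)) =
      (p.map (algebraMap k E) - C (⟨_, hpE⟩ : E)).map (algebraMap E (RatFunc k)) := by
    simp only [hS, Polynomial.map_sub, Polynomial.map_map, map_C]
    congr 1
  have hdvd : φ.map (algebraMap E (RatFunc k)) ∣ S.map (algebraMap k[X] (RatFunc k)) := by
    rw [hSmap]
    refine Polynomial.map_dvd _ (minpoly.dvd _ _ ?_)
    rw [map_sub, aeval_map_algebraMap, aeval_C]
    simp [← RatFunc.algebraMap_X, aeval_algebraMap_apply]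
  obtain ⟨F, hF⟩ := IsIntegrallyClosed.eq_map_mul_C_of_dvd (RatFunc k) hSm hdvd
  rw [(hφm.map _).leadingCoeff, C_1, mul_one] at hF
  have hinj : Function.Injective (algebraMap k[X] (RatFunc k)) :=
    IsFractionRing.injective _ _
  have hFm : F.Monic := hinj.monic_map_iff.2 (hF ▸ hφm.map _)
  have hFdeg : F.natDegree = φ.natDegree := by
    rw [← natDegree_map_eq_of_injective hinj, hF, natDegree_map]
  have hFS : F ∣ S := (map_dvd_map _ hinj hFm).1 (hF ▸ hdvd)
  have hcoeff (i : ℕ) : algebraMap k[X] (RatFunc k) (F.coeff i) ∈ E := by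
    rw [← coeff_map, hF, coeff_map]
    exact (φ.coeff i).2
  obtain ⟨i, hi⟩ : ∃ i, 0 < (F.coeff i).natDegree := by
    by_contra! hcon
    have hconst : F = (F.map (evalRingHom 0)).map C := by
      ext1 i
      rw [coeff_map, coeff_map, eq_C_of_natDegree_le_zero (hcon i)]
      simp
    have hroot : F.eval X = 0 := by
      apply hinj
      rw [← eval₂_at_apply, ← eval_map, hF, RatFunc.algebraMap_X, map_zero, eval_map, ← aeval_def]
      exact minpoly.aeval _ _
    rw [hconst, eval_map, eval₂_C_X] at hroot
    exact hFm.ne_zero (by rw [hconst, hroot, Polynomial.map_zero])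
  refine ⟨F.coeff i, hi, hcoeff i, ?_⟩
  have := natDegree_coeff_add_le_of_dvd_sub hp hp0 hFm hFS i (fun h => by simp [h] at hi)
  omega

theorem exists_eq_comp_of_mem {E : IntermediateField k (RatFunc k)} {W : k[X]}
    (hW : 0 < W.natDegree) (hWE : algebraMap k[X] (RatFunc k) W ∈ E)
    (hdeg : W.natDegree ≤ (minpoly E (RatFunc.X : RatFunc k)).natDegree)
    {P : k[X]} (hP : algebraMap k[X] (RatFunc k) P ∈ E) : ∃ c : k[X], P = c.comp W := by
  obtain ⟨c, hc⟩ := exists_sum_comp_mul_X_pow hW P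
  let w : E := ⟨_, hWE⟩
  let Q : E[X] := ∑ j ∈ Finset.range W.natDegree, C (aeval w (c j)) * X ^ j - C ⟨_, hP⟩
  have hval (j : ℕ) : (aeval w (c j) : RatFunc k) =
      algebraMap k[X] (RatFunc k) ((c j).comp W) := by
    rw [comp_eq_aeval, ← aeval_algebraMap_apply]
    exact (aeval_algebraMap_apply (RatFunc k) w (c j)).symm
  have hQdeg : Q.degree < W.natDegree := by
    refine (degree_sub_le _ _).trans_lt (max_lt ?_ ?_)
    · refine (degree_sum_le _ _).trans_lt ((Finset.sup_lt_iff (WithBot.bot_lt_coe _)).2 ?_)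
      intro j hj
      exact (degree_C_mul_X_pow_le _ _).trans_lt (by exact_mod_cast Finset.mem_range.1 hj)
    · exact degree_C_le.trans_lt (by exact_mod_cast hW)
  have hQroot : aeval (RatFunc.X : RatFunc k) Q = 0 := by
    simp only [Q, map_sub, map_sum, map_mul, aeval_C, map_pow, aeval_X,
      IntermediateField.algebraMap_apply, hval]
    rw [sub_eq_zero]
    conv_rhs => rw [hc]
    simp [RatFunc.algebraMap_X]
  have hQ0 : Q = 0 := by
    by_contra h
    have h1 := minpoly.degree_le_of_ne_zero E _ h hQroot
    have h2 := natDegree_le_natDegree h1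
    have h3 := (natDegree_lt_iff_degree_lt h).2 hQdeg
    omega
  refine ⟨c 0, ?_⟩
  have h0 := congr_arg (coeff · 0) hQ0
  simp only [Q, coeff_sub, finsetSum_coeff, coeff_C_mul, coeff_X_pow, coeff_C_zero,
    coeff_zero] at h0
  rw [Finset.sum_eq_single_of_mem 0 (Finset.mem_range.2 hW) (by intro b _ hb; simp [hb.symm])] at h0
  apply IsFractionRing.injective k[X] (RatFunc k)
  have := congr_arg (algebraMap E (RatFunc k)) (sub_eq_zero.1 h0)
  simpa [hval] using this.symm

theorem adjoin_pair_eq_top_of_forall_comp {p q : k[X]} (hp : 0 < p.natDegree)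
    (h : ∀ p₁ q₁ W : k[X], p = p₁.comp W → q = q₁.comp W → W.natDegree ≤ 1) :
    IntermediateField.adjoin k
      {algebraMap k[X] (RatFunc k) p, algebraMap k[X] (RatFunc k) q} = ⊤ := by
  set E := IntermediateField.adjoin k
    {algebraMap k[X] (RatFunc k) p, algebraMap k[X] (RatFunc k) q}
  have hpE : algebraMap k[X] (RatFunc k) p ∈ E := IntermediateField.subset_adjoin _ _ (by simp)
  have hqE : algebraMap k[X] (RatFunc k) q ∈ E := IntermediateField.subset_adjoin _ _ (by simp)
  have hCE (c : k) : algebraMap k[X] (RatFunc k) (C c) ∈ E := by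
    rw [← algebraMap_eq, ← IsScalarTower.algebraMap_apply]
    exact E.algebraMap_mem c
  have hp0 : p ≠ 0 := by rintro rfl; simp at hp
  have hp'deg : (p * C p.leadingCoeff⁻¹).natDegree = p.natDegree :=
    natDegree_mul_leadingCoeff_inv p hp0
  obtain ⟨W, hW, hWE, hWdeg⟩ := exists_mem_natDegree_le_natDegree_minpoly
    (monic_mul_leadingCoeff_inv hp0) (hp'deg ▸ hp) (by
      rw [map_mul]
      exact mul_mem hpE (hCE _) : algebraMap k[X] (RatFunc k) (p * C p.leadingCoeff⁻¹) ∈ E)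
  obtain ⟨p₁, hp₁⟩ := exists_eq_comp_of_mem hW hWE hWdeg hpE
  obtain ⟨q₁, hq₁⟩ := exists_eq_comp_of_mem hW hWE hWdeg hqE
  have hW1 : W.natDegree = 1 := le_antisymm (h p₁ q₁ W hp₁ hq₁) hW
  have hlead : W.coeff 1 ≠ 0 := by
    rw [← hW1, coeff_natDegree, leadingCoeff_ne_zero]
    rintro rfl
    simp at hW
  have hX : (X : k[X]) = C (W.coeff 1)⁻¹ * (W - C (W.coeff 0)) := by
    conv_rhs => rw [eq_X_add_C_of_natDegree_le_one hW1.le]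
    simp [← mul_assoc, ← C_mul, inv_mul_cancel₀ hlead]
  have hXE : (RatFunc.X : RatFunc k) ∈ E := by
    rw [← RatFunc.algebraMap_X, hX, map_mul, map_sub]
    exact mul_mem (hCE _) (sub_mem hWE (hCE _))
  rw [eq_top_iff, ← RatFunc.adjoin_X, IntermediateField.adjoin_simple_le_iff]
  exact hXE

theorem irreducible_map_C_sub_C_of_adjoin_pair_eq_top {f g p q : k[X]} (hp : 0 < p.natDegree)
    (heq : f.comp p = g.comp q) (hdeg : g.natDegree = p.natDegree)
    (htop : IntermediateField.adjoin k
      {algebraMap k[X] (RatFunc k) p, algebraMap k[X] (RatFunc k) q} = ⊤) :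
    Irreducible (g.map C - C f : k[X][X]) := by
  have hg : 0 < g.natDegree := hdeg ▸ hp
  have hg0 : g.leadingCoeff ≠ 0 := leadingCoeff_ne_zero.2 (by rintro rfl; simp at hg)
  set P := algebraMap k[X] (RatFunc k) p with hP
  set Q := algebraMap k[X] (RatFunc k) q with hQ
  let K := IntermediateField.adjoin k {P}
  let P' : K := IntermediateField.AdjoinSimple.gen k P
  let S : k[X][X] := C (C g.leadingCoeff⁻¹) * (g.map C - C f)
  have hSm : S.Monic := by
    have : S = (C g.leadingCoeff⁻¹ * g).map C - C (C g.leadingCoeff⁻¹ * f) := by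
      simp [S, mul_sub]
    have hm : (C g.leadingCoeff⁻¹ * g).Monic := by
      simp [Monic, hg0]
    rw [this]
    refine (hm.map C).sub_of_left ?_
    rw [degree_map, degree_C_mul (inv_ne_zero hg0)]
    exact degree_C_le.trans_lt (natDegree_pos_iff_degree_pos.1 hg)
  have hSdeg : S.natDegree = p.natDegree := by
    rw [natDegree_C_mul (by simpa using hg0), natDegree_sub_C, natDegree_map, hdeg]
  let φ : k[X] →+* K := (aeval P').toRingHom
  have hφC : φ.comp C = algebraMap k K := by ext; simp [φ]
  have hroot : aeval Q (S.map φ) = 0 := by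
    have h1 : aeval Q ((g.map C - C f : k[X][X]).map φ) = 0 := by
      rw [Polynomial.map_sub, Polynomial.map_map, hφC, map_C, map_sub, aeval_map_algebraMap, aeval_C]
      have h2 : algebraMap K (RatFunc k) (φ f) = aeval P f :=
        (aeval_algebraMap_apply (RatFunc k) P' f).symm
      rw [h2, hP, hQ, aeval_algebraMap_apply, aeval_algebraMap_apply, ← comp_eq_aeval,
        ← comp_eq_aeval, heq, sub_self]
    rw [Polynomial.map_mul, map_mul, h1, mul_zero]
  have hint : IsIntegral K Q := ⟨_, hSm.map φ, hroot⟩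
  have htop' : IntermediateField.adjoin K {Q} = ⊤ := by
    rw [← IntermediateField.restrictScalars_eq_top_iff (K := k),
      IntermediateField.adjoin_simple_adjoin_simple]
    exact htop
  have hmin : (minpoly K Q).natDegree = p.natDegree := by
    rw [← IntermediateField.adjoin.finrank hint, htop', IntermediateField.finrank_top',
      RatFunc.finrank_eq_max_natDegree, hP, RatFunc.num_algebraMap, RatFunc.denom_algebraMap]
    simp
  have hSmin : S.map φ = minpoly K Q :=
    eq_of_monic_of_dvd_of_natDegree_le (minpoly.monic hint) (hSm.map φ) (minpoly.dvd _ _ hroot)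
      (by rw [hSm.natDegree_map, hSdeg, hmin])
  have hSirr : Irreducible S :=
    hSm.irreducible_of_irreducible_map φ _ (hSmin ▸ minpoly.irreducible hint)
  exact (irreducible_isUnit_mul (by simpa using hg0)).1 hSirr

end

theorem stmt_3 (f g p q : Polynomial ℂ)
    (hf : 0 < f.natDegree) (hg : 0 < g.natDegree)
    (hp : 0 < p.natDegree) (hq : 0 < q.natDegree)
    (heq : f.comp p = g.comp q)
    (hnc : NoCommonRightFactor p q)
    (hdeg : f.natDegree = q.natDegree ∧ g.natDegree = p.natDegree) :
    Irreducible (curvePoly f g) := by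
  have h := irreducible_map_C_sub_C_of_adjoin_pair_eq_top hp heq hdeg.2
    (adjoin_pair_eq_top_of_forall_comp hp hnc)
  rw [curvePoly, ← neg_sub]
  exact (Associated.refl _).neg_left.irreducible_iff.2 h
end

section
/- Let s be a finite multiset of natural numbers each of which is at least 2. Then the sum over n ∈ s of (1 − 1/n), computed in ℚ, equals 2 if and only if s is one of the multisets {2,2,2,2}, {3,3,3}, {2,4,4}, {2,3,6}. -/
theorem one_div_natCast_le_half {n : ℕ} (hn : 2 ≤ n) : 1 / (n : ℚ) ≤ 1 / 2 :=
  one_div_le_one_div_of_le two_pos (by exact_mod_cast hn)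

theorem one_div_natCast_pos {n : ℕ} (hn : 2 ≤ n) : 0 < 1 / (n : ℚ) :=
  one_div_pos.2 (by exact_mod_cast two_pos.trans_le hn)

theorem eq_two_of_half_le_one_div {n : ℕ} (hn : 2 ≤ n) (h : 1 / 2 ≤ 1 / (n : ℚ)) : n = 2 := by
  have hpos : (0 : ℚ) < n := by exact_mod_cast two_pos.trans_le hn
  have hle : (n : ℚ) ≤ 2 := (one_div_le_one_div two_pos hpos).1 h
  exact le_antisymm (by exact_mod_cast hle) hn

/-- The ordered solutions of `1 / a + 1 / b + 1 / c = 1` in natural numbers at least two. -/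
theorem eq_of_sum_one_div_eq_one {a b c : ℕ} (ha : 2 ≤ a) (hab : a ≤ b) (hbc : b ≤ c)
    (h : 1 / (a : ℚ) + 1 / b + 1 / c = 1) :
    (a = 3 ∧ b = 3 ∧ c = 3) ∨ (a = 2 ∧ b = 4 ∧ c = 4) ∨ (a = 2 ∧ b = 3 ∧ c = 6) := by
  have ha' : (a : ℚ) ≠ 0 := by norm_cast; omega
  have hb' : (b : ℚ) ≠ 0 := by norm_cast; omega
  have hc' : (c : ℚ) ≠ 0 := by norm_cast; omega
  have key : b * c + a * c + a * b = a * b * c := by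
    field_simp at h
    have h' : (b * c + a * c + a * b : ℚ) = a * b * c := by linarith
    exact_mod_cast h'
  have ha3 : a ≤ 3 := by
    by_contra! hlt
    nlinarith [Nat.mul_le_mul hab (le_refl c), Nat.mul_le_mul hab hbc,
      Nat.mul_le_mul_right (b * c) hlt, Nat.mul_le_mul_left b (hab.trans hbc),
      Nat.mul_pos (show 0 < b by omega) (show 0 < c by omega)]
  have hb4 : b ≤ 4 := by
    by_contra! hlt
    interval_cases a <;> nlinarith
  interval_cases a <;> interval_cases b <;> omega

theorem stmt_7 (s : Multiset ℕ) (hs : ∀ n ∈ s, 2 ≤ n) :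
    (s.map (fun n => 1 - 1 / (n : ℚ))).sum = 2 ↔
      s = {2, 2, 2, 2} ∨ s = {3, 3, 3} ∨ s = {2, 4, 4} ∨ s = {2, 3, 6} := by
  constructor
  · intro h
    obtain ⟨l, hsort, rfl⟩ : ∃ l : List ℕ, l.Pairwise (· ≤ ·) ∧ (l : Multiset ℕ) = s :=
      ⟨s.sort (· ≤ ·), s.pairwise_sort _, s.sort_eq _⟩
    simp only [Multiset.mem_coe] at hs
    replace h : (l.map (fun n : ℕ => 1 - 1 / (n : ℚ))).sum = 2 := by
      simpa [Multiset.bind_def, Multiset.pure_def, Multiset.bind_singleton, Function.comp_def]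
        using h
    match l with
    | [] => norm_num at h
    | [a] =>
      have := one_div_natCast_pos (hs a (by simp))
      simp only [List.map_cons, List.map_nil, List.sum_cons, List.sum_nil] at h
      linarith
    | [a, b] =>
      have := one_div_natCast_pos (hs a (by simp))
      have := one_div_natCast_pos (hs b (by simp))
      simp only [List.map_cons, List.map_nil, List.sum_cons, List.sum_nil] at h
      linarith
    | [a, b, c] =>
      simp only [List.map_cons, List.map_nil, List.sum_cons, List.sum_nil] at h
      have hab : a ≤ b := by simp at hsort; omega
      have hbc : b ≤ c := by simp at hsort; omega
      rcases eq_of_sum_one_div_eq_one (hs a (by simp)) hab hbc (by linarith) with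
        ⟨rfl, rfl, rfl⟩ | ⟨rfl, rfl, rfl⟩ | ⟨rfl, rfl, rfl⟩
      · exact .inr (.inl rfl)
      · exact .inr (.inr (.inl rfl))
      · exact .inr (.inr (.inr rfl))
    | a :: b :: c :: d :: t =>
      have ha := hs a (by simp)
      have hb := hs b (by simp)
      have hc := hs c (by simp)
      have hd := hs d (by simp)
      have ha' := one_div_natCast_le_half ha
      have hb' := one_div_natCast_le_half hb
      have hc' := one_div_natCast_le_half hc
      have hd' := one_div_natCast_le_half hd
      simp only [List.map_cons, List.sum_cons] at h
      match t with
      | [] =>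
        simp only [List.map_nil, List.sum_nil] at h
        obtain rfl := eq_two_of_half_le_one_div ha (by linarith)
        obtain rfl := eq_two_of_half_le_one_div hb (by linarith)
        obtain rfl := eq_two_of_half_le_one_div hc (by linarith)
        obtain rfl := eq_two_of_half_le_one_div hd (by linarith)
        exact .inl rfl
      | e :: t =>
        have he := one_div_natCast_le_half (hs e (by simp))
        have ht : 0 ≤ (t.map (fun n : ℕ => 1 - 1 / (n : ℚ))).sum := by
          refine List.sum_nonneg fun x hx => ?_
          obtain ⟨n, hn, rfl⟩ := List.mem_map.1 hx
          linarith [one_div_natCast_le_half (hs n (by simp [hn]))]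
        simp only [List.map_cons, List.sum_cons] at h
        linarith
  · rintro (rfl | rfl | rfl | rfl) <;> norm_num
end

section
/- Let s be a finite multiset of natural numbers each of which is at least 2, with card s ≥ 3. Then the sum over n ∈ s of (1 − 1/n), computed in ℚ, is strictly less than 2 if and only if s = {2,2,n} for some n ≥ 2, or s is one of the multisets {2,3,3}, {2,3,4}, {2,3,5}. -/
/-- Each ramification index contributes at least `1 / 2` to the sum. -/
theorem card_div_two_le_sum_one_sub_inv (s : Multiset ℕ) (hs : ∀ n ∈ s, 2 ≤ n) :
    (Multiset.card s : ℚ) / 2 ≤ (s.map (fun n : ℕ => 1 - 1 / (n : ℚ))).sum := by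
  have h : Multiset.card s • (1 / 2 : ℚ) ≤ (s.map (fun n : ℕ => 1 - 1 / (n : ℚ))).sum := by
    rw [← Multiset.card_map (fun n : ℕ => 1 - 1 / (n : ℚ)) s]
    refine Multiset.card_nsmul_le_sum (s := s.map fun n : ℕ => 1 - 1 / (n : ℚ)) fun x hx => ?_
    obtain ⟨n, hn, rfl⟩ := Multiset.mem_map.mp hx
    have h2 : (2 : ℚ) ≤ n := by exact_mod_cast hs n hn
    have : 1 / (n : ℚ) ≤ 1 / 2 := one_div_le_one_div_of_le two_pos h2
    linarith
  rw [nsmul_eq_mul] at h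
  linarith

theorem Multiset.exists_le_le_of_card_eq_three {α : Type*} [LinearOrder α] {s : Multiset α}
    (hs : Multiset.card s = 3) : ∃ a b c, a ≤ b ∧ b ≤ c ∧ s = {a, b, c} := by
  obtain ⟨a, b, c, h⟩ := List.length_eq_three.mp ((s.length_sort (· ≤ ·)).trans hs)
  have hsorted := s.pairwise_sort (· ≤ ·)
  rw [h] at hsorted
  simp only [List.pairwise_cons, List.mem_cons] at hsorted
  refine ⟨a, b, c, hsorted.1 b (by simp), hsorted.2.1 c (by simp), ?_⟩
  rw [← s.sort_eq (· ≤ ·), h]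
  rfl

theorem eq_of_mul_lt_of_le_of_le {a b c : ℕ} (ha : 2 ≤ a) (hab : a ≤ b) (hbc : b ≤ c)
    (h : a * b * c < b * c + a * c + a * b) :
    a = 2 ∧ (b = 2 ∨ b = 3 ∧ (c = 3 ∨ c = 4 ∨ c = 5)) := by
  have ha3 : a < 3 := by
    by_contra! ha3
    have h1 : 3 * (b * c) ≤ a * (b * c) := Nat.mul_le_mul_right _ ha3
    have h2 : a * c ≤ b * c := Nat.mul_le_mul_right _ hab
    have h3 : a * b ≤ b * c := by nlinarith
    nlinarith
  obtain rfl : a = 2 := by omega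
  have hb4 : b < 4 := by
    by_contra! hb4
    nlinarith
  interval_cases b <;> omega

theorem stmt_8 (s : Multiset ℕ) (hs : ∀ n ∈ s, 2 ≤ n) (hcard : 3 ≤ Multiset.card s) :
    (s.map (fun n => 1 - 1 / (n : ℚ))).sum < 2 ↔
      (∃ n : ℕ, 2 ≤ n ∧ s = {2, 2, n}) ∨ s = {2, 3, 3} ∨ s = {2, 3, 4} ∨ s = {2, 3, 5} := by
  simp only [Multiset.bind_def, Multiset.pure_def, Multiset.bind_singleton, Multiset.map_map,
    Function.comp_def]
  constructor
  · intro h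
    have hle := card_div_two_le_sum_one_sub_inv s hs
    have hlt : (Multiset.card s : ℚ) < 4 := by linarith
    have hlt' : Multiset.card s < 4 := by exact_mod_cast hlt
    obtain ⟨a, b, c, hab, hbc, rfl⟩ :=
      Multiset.exists_le_le_of_card_eq_three (show Multiset.card s = 3 by omega)
    have ha : 2 ≤ a := hs a (by simp)
    have hb : 2 ≤ b := ha.trans hab
    have hc : 2 ≤ c := hb.trans hbc
    have ha0 : (0 : ℚ) < a := by exact_mod_cast two_pos.trans_le ha
    have hb0 : (0 : ℚ) < b := by exact_mod_cast two_pos.trans_le hb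
    have hc0 : (0 : ℚ) < c := by exact_mod_cast two_pos.trans_le hc
    have hmul : a * b * c < b * c + a * c + a * b := by
      have hsum : (1 : ℚ) < 1 / a + 1 / b + 1 / c := by
        simp only [Multiset.insert_eq_cons, Multiset.map_cons, Multiset.map_singleton,
          Multiset.sum_cons, Multiset.sum_singleton] at h
        linarith
      have heq : (1 / a + 1 / b + 1 / c : ℚ) = (b * c + a * c + a * b) / (a * b * c) := by
        field_simp
      rw [heq, one_lt_div (by positivity)] at hsum
      exact_mod_cast hsum
    obtain ⟨rfl, rfl | ⟨rfl, rfl | rfl | rfl⟩⟩ := eq_of_mul_lt_of_le_of_le ha hab hbc hmul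
    · exact Or.inl ⟨c, hc, rfl⟩
    all_goals simp
  · rintro (⟨n, hn, rfl⟩ | rfl | rfl | rfl)
    · have hn0 : (0 : ℚ) < 1 / n := one_div_pos.mpr (by exact_mod_cast two_pos.trans_le hn)
      simp only [Multiset.insert_eq_cons, Multiset.map_cons, Multiset.map_singleton,
        Multiset.sum_cons, Multiset.sum_singleton]
      push_cast
      linarith
    all_goals
      simp only [Multiset.insert_eq_cons, Multiset.map_cons, Multiset.map_singleton,
        Multiset.sum_cons, Multiset.sum_singleton]
      norm_num
end

section
/- Let z ∈ ℂ satisfy z ≠ 0, 2z² ≠ 1, and z² ≠ 2. Set X = (z² + z⁻²)/2 and B = (z² − 2)/(z − 2z³). Then (64X³ − 64X² − 23X + 24)/(4X − 5)² = (B² + B⁻²)/2. Equivalently, the rational functions A(w) = (64w³−64w²−23w+24)/(4w−5)², X(z) = ½(z²+1/z²), B(z) = (z²−2)/(z−2z³) satisfy A ∘ X = X ∘ B wherever defined. -/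
theorem stmt_13 (z : ℂ) (hz : z ≠ 0) (h1 : 2 * z ^ 2 ≠ 1) (h2 : z ^ 2 ≠ 2)
    (Xv Bv : ℂ)
    (hX : Xv = (z ^ 2 + (z ^ 2)⁻¹) / 2)
    (hB : Bv = (z ^ 2 - 2) / (z - 2 * z ^ 3)) :
    (64 * Xv ^ 3 - 64 * Xv ^ 2 - 23 * Xv + 24) / (4 * Xv - 5) ^ 2 =
      (Bv ^ 2 + (Bv ^ 2)⁻¹) / 2 := by
  have ha : 2 * z ^ 2 - 1 ≠ 0 := sub_ne_zero.mpr h1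
  have hb : z ^ 2 - 2 ≠ 0 := sub_ne_zero.mpr h2
  have hX5 : 4 * Xv - 5 = (2 * z ^ 2 - 1) * (z ^ 2 - 2) / z ^ 2 := by
    rw [hX]
    field_simp
    ring
  have hB' : Bv = -((z ^ 2 - 2) / (z * (2 * z ^ 2 - 1))) := by
    rw [hB, ← div_neg]
    congr 1
    ring
  rw [hX5, hB', hX]
  field_simp
  ring
end

section
/- Let z ∈ ℂ satisfy z ≠ 0, z³ ≠ −1, and z³ ≠ 8. Set X(w) = w³(8 − w³)³ / (64(w³ + 1)³), B = (2 − z³)/(3z), and A(x) = (4x − 1)³/(27x). Then A(X(z)) = X(B(z)). (Under these hypotheses X(z) ≠ 0 and B³ + 1 = −(z³−8)(z³+1)²/(27z³) ≠ 0, so both sides are defined.) -/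
theorem stmt_15 (z : ℂ) (hz : z ≠ 0) (h1 : z ^ 3 ≠ -1) (h2 : z ^ 3 ≠ 8)
    (Xf : ℂ → ℂ) (hX : ∀ w : ℂ, Xf w = w ^ 3 * (8 - w ^ 3) ^ 3 / (64 * (w ^ 3 + 1) ^ 3))
    (B : ℂ) (hB : B = (2 - z ^ 3) / (3 * z))
    (A : ℂ → ℂ) (hA : ∀ x : ℂ, A x = (4 * x - 1) ^ 3 / (27 * x)) :
    A (Xf z) = Xf B := by
  have hB3 : B ^ 3 = (2 - z ^ 3) ^ 3 / (27 * z ^ 3) := by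
    rw [hB, div_pow, mul_pow]
    norm_num
  rw [hA, hX, hX, hB3]
  have ht : z ^ 3 ≠ 0 := pow_ne_zero 3 hz
  generalize z ^ 3 = t at *
  have h1' : t + 1 ≠ 0 := fun h => h1 (eq_neg_of_add_eq_zero_left h)
  have h2' : 8 - t ≠ 0 := sub_ne_zero.mpr h2.symm
  have hden : (2 - t) ^ 3 / (27 * t) + 1 = (8 - t) * (t + 1) ^ 2 / (27 * t) := by
    field_simp
    ring
  rw [hden]
  field_simp
  ring
end

section
/- Let f, g, p, q be nonconstant polynomials over ℂ such that f ∘ p = g ∘ q, the bivariate polynomial f(X) − g(Y) is irreducible in ℂ[X,Y], and p and q have no nontrivial common right compositional factor. For a nonconstant polynomial h and w ∈ ℂ, let ν_h(w) denote the least common multiple of the local degrees e_u(h) over all u in the fiber h⁻¹(w). Then for every z ∈ ℂ: ν_f(g(z)) = ν_q(z) · gcd(e_z(g), ν_f(g(z))). -/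
open Polynomial

/-- `ν_h(w)`: the least common multiple of the local degrees of `h` over the fiber
`h⁻¹(w)`. -/
noncomputable def nuPoly (h : Polynomial ℂ) (w : ℂ) : ℕ :=
  ((h - C w).roots.toFinset).lcm (localDeg h)

/-- `ν¹_h(u) = ν_h(h(u)) / e_u(h)`. -/
noncomputable def nuOnePoly (h : Polynomial ℂ) (u : ℂ) : ℕ :=
  nuPoly h (h.eval u) / localDeg h u

open Filter Topology

theorem sub_C_ne_zero_of_natDegree_pos {h : ℂ[X]} (hh : 0 < h.natDegree) (w : ℂ) :
    h - C w ≠ 0 := by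
  intro H
  rw [sub_eq_zero.mp H, natDegree_C] at hh
  exact hh.false

theorem exists_eq_X_sub_C_pow_localDeg_mul {h : ℂ[X]} (hh : 0 < h.natDegree) (u : ℂ) :
    ∃ V : ℂ[X], h - C (h.eval u) = (X - C u) ^ localDeg h u * V ∧ V.eval u ≠ 0 := by
  obtain ⟨V, hV, hd⟩ := exists_eq_pow_rootMultiplicity_mul_and_not_dvd _
    (sub_C_ne_zero_of_natDegree_pos hh (h.eval u)) u
  exact ⟨V, hV, fun H => hd (dvd_iff_isRoot.mpr H)⟩

theorem localDeg_eq_of_eq_mul {h V : ℂ[X]} {u : ℂ} {k : ℕ}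
    (e : h - C (h.eval u) = (X - C u) ^ k * V) (hV : V.eval u ≠ 0) : localDeg h u = k := by
  have hV0 : V ≠ 0 := by rintro rfl; simp at hV
  rw [localDeg, e, mul_comm, rootMultiplicity_mul_X_sub_C_pow hV0,
    rootMultiplicity_eq_zero (by simpa using hV), zero_add]

theorem localDeg_pos_s16 {h : ℂ[X]} (hh : 0 < h.natDegree) (u : ℂ) : 0 < localDeg h u :=
  (rootMultiplicity_pos (sub_C_ne_zero_of_natDegree_pos hh _)).mpr (by simp)

theorem localDeg_comp {f p : ℂ[X]} (hf : 0 < f.natDegree) (hp : 0 < p.natDegree) (u : ℂ) :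
    localDeg (f.comp p) u = localDeg p u * localDeg f (p.eval u) := by
  obtain ⟨V, hV, hV0⟩ := exists_eq_X_sub_C_pow_localDeg_mul hf (p.eval u)
  obtain ⟨P, hP, hP0⟩ := exists_eq_X_sub_C_pow_localDeg_mul hp u
  refine localDeg_eq_of_eq_mul (V := P ^ localDeg f (p.eval u) * V.comp p) ?_ ?_
  · have := congrArg (fun r : ℂ[X] => r.comp p) hV
    simp only [sub_comp, C_comp, mul_comp, pow_comp, X_comp] at this
    rw [eval_comp, this, hP]
    ring
  · simpa using ⟨fun h => absurd h hP0, hV0⟩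

theorem nuPoly_dvd_iff {h : ℂ[X]} (hh : 0 < h.natDegree) (w : ℂ) (k : ℕ) :
    nuPoly h w ∣ k ↔ ∀ u, h.eval u = w → localDeg h u ∣ k := by
  simp [nuPoly, Finset.lcm_dvd_iff, sub_C_ne_zero_of_natDegree_pos hh w, sub_eq_zero]

/-- Near `u` a polynomial is a power of a local coordinate, up to an additive constant. -/
theorem exists_analyticAt_pow_localDeg {h : ℂ[X]} (hh : 0 < h.natDegree) (u : ℂ) :
    ∃ s : ℂ → ℂ, AnalyticAt ℂ s u ∧ s u = 0 ∧ deriv s u ≠ 0 ∧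
      ∀ t, h.eval t = h.eval u + s t ^ localDeg h u := by
  obtain ⟨V, hV, hV0⟩ := exists_eq_X_sub_C_pow_localDeg_mul hh u
  have hk := localDeg_pos_s16 hh u
  set k := localDeg h u
  obtain ⟨c, hc⟩ := IsAlgClosed.exists_pow_nat_eq (V.eval u) hk
  have hc0 : c ≠ 0 := by
    rintro rfl
    rw [zero_pow hk.ne'] at hc
    exact hV0 hc.symm
  let r : ℂ → ℂ := fun t => c * (V.eval t / V.eval u) ^ ((k : ℂ)⁻¹)
  have hVa : AnalyticAt ℂ (fun t => V.eval t) u := by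
    simpa using AnalyticAt.aeval_polynomial (analyticAt_id (𝕜 := ℂ) (z := u)) V
  have hr : AnalyticAt ℂ r u := by
    refine analyticAt_const.mul (AnalyticAt.cpow (hVa.div analyticAt_const hV0) analyticAt_const ?_)
    simp [div_self hV0]
  have hru : r u = c := by simp [r, div_self hV0]
  refine ⟨fun t => (t - u) * r t, (analyticAt_id.sub analyticAt_const).mul hr, by simp, ?_, ?_⟩
  · have h1 : HasDerivAt (fun t => (t - u) * r t) (1 * r u + (u - u) * deriv r u) u :=
      ((hasDerivAt_id u).sub_const u).mul hr.differentiableAt.hasDerivAt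
    rw [h1.deriv]
    simpa [hru] using hc0
  · intro t
    have := congrArg (eval t) hV
    simp only [eval_sub, eval_C, eval_mul, eval_pow, eval_X] at this
    simp only [r]
    rw [mul_pow, mul_pow, hc, Complex.cpow_nat_inv_pow _ hk.ne', mul_div_cancel₀ _ hV0, ← this]
    ring

theorem eventually_eq_const_mul_of_pow_eq {a b : ℂ → ℂ} {u : ℂ} {e : ℕ} (he : 0 < e)
    (ha : AnalyticAt ℂ a u) (hb : AnalyticAt ℂ b u) (h : ∀ᶠ t in 𝓝 u, a t ^ e = b t ^ e) :
    ∃ c : ℂ, ∀ᶠ t in 𝓝 u, a t = c * b t := by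
  by_contra H
  rw [not_exists] at H
  have key : ∀ᶠ t in 𝓝[≠] u, ∀ c ∈ nthRootsFinset e (1 : ℂ), a t - c * b t ≠ 0 := by
    rw [eventually_all_finset]
    intro c _
    refine ((ha.sub (analyticAt_const.mul hb)).eventually_eq_zero_or_eventually_ne_zero).resolve_left
      fun h0 => H c (h0.mono fun t ht => sub_eq_zero.mp ht)
  obtain ⟨t, ht, ht'⟩ := (key.and (h.filter_mono nhdsWithin_le_nhds)).exists
  have := (Complex.isPrimitiveRoot_exp e he.ne').pow_sub_pow_eq_prod_sub_mul (a t) (b t) he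
  rw [ht', sub_self] at this
  exact Finset.prod_ne_zero_iff.mpr ht this.symm

/-- Let `s` be a local coordinate at `u` in which `f ∘ p` is a power. A rotation `σ` of `s` by a root
of unity of order dividing the local degree of `p` leaves `p` invariant. -/
theorem eventually_eval_comp_eq {f p : ℂ[X]} (hf : 0 < f.natDegree) (hp : 0 < p.natDegree)
    {u ζ : ℂ} {s σ : ℂ → ℂ} (hs : AnalyticAt ℂ s u)
    (hpow : ∀ t, (f.comp p).eval t = (f.comp p).eval u + s t ^ localDeg (f.comp p) u)
    (hσ : Tendsto σ (𝓝 u) (𝓝 u)) (hsσ : ∀ᶠ t in 𝓝 u, s (σ t) = ζ * s t)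
    (hζ : ζ ^ localDeg p u = 1) : ∀ᶠ t in 𝓝 u, p.eval (σ t) = p.eval t := by
  obtain ⟨φ, hφ, -, hφ', hφpow⟩ := exists_analyticAt_pow_localDeg hf (p.eval u)
  have hpa : AnalyticAt ℂ (fun t => p.eval t) u := by
    simpa using AnalyticAt.aeval_polynomial (analyticAt_id (𝕜 := ℂ) (z := u)) p
  obtain ⟨c, hc⟩ := eventually_eq_const_mul_of_pow_eq (a := fun t => φ (p.eval t))
    (b := fun t => s t ^ localDeg p u) (localDeg_pos_s16 hf (p.eval u)) (AnalyticAt.comp (f := fun t => p.eval t) hφ hpa) (hs.pow _)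
    (Eventually.of_forall fun t => by
      have h1 := hpow t
      rw [localDeg_comp hf hp, eval_comp, eval_comp, hφpow (p.eval t), add_right_inj] at h1
      rw [h1, pow_mul])
  have hinj := hφ.hasStrictDerivAt.hasStrictFDerivAt_equiv hφ' |>.eventually_left_inverse
  have hpt : Tendsto (fun t => p.eval t) (𝓝 u) (𝓝 (p.eval u)) := hpa.continuousAt
  filter_upwards [hc, hσ.eventually hc, hsσ, hpt.eventually hinj,
    (hpt.comp hσ).eventually hinj] with t h1 h2 h3 h4 h5
  have : φ (p.eval (σ t)) = φ (p.eval t) := by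
    rw [h1, h2, h3, mul_pow, hζ, one_mul]
  simp only [Function.comp_apply] at h5
  rw [← h5, this, h4]

/-- If `t ↦ (p t, q t)` is generically injective and `f ∘ p = g ∘ q`, then the local degrees of
`p` and `q` are coprime: otherwise rotating a local coordinate of `f ∘ p` by a root of unity would
preserve both `p` and `q`. -/
theorem coprime_localDeg {f g p q : ℂ[X]} (hf : 0 < f.natDegree) (hg : 0 < g.natDegree)
    (hp : 0 < p.natDegree) (hq : 0 < q.natDegree) (heq : f.comp p = g.comp q) {b : ℂ[X]}
    (hb : b ≠ 0)
    (hinj : ∀ t t', b.eval t ≠ 0 → p.eval t' = p.eval t → q.eval t' = q.eval t → t' = t) (u : ℂ) :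
    (localDeg p u).Coprime (localDeg q u) := by
  by_contra hd
  have hd0 : Nat.gcd (localDeg p u) (localDeg q u) ≠ 0 :=
    (Nat.gcd_pos_of_pos_left _ (localDeg_pos_s16 hp u)).ne'
  set d := Nat.gcd (localDeg p u) (localDeg q u)
  have hζ := Complex.isPrimitiveRoot_exp d hd0
  set ζ := Complex.exp (2 * Real.pi * Complex.I / d)
  have hζ1 : ζ ≠ 1 := hζ.ne_one (by
    have : d ≠ 1 := hd
    omega)
  obtain ⟨s, hs, hsu, hs', hspow⟩ := exists_analyticAt_pow_localDeg (h := f.comp p)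
    (by rw [natDegree_comp]; positivity) u
  have hinv := hs.hasStrictDerivAt.hasStrictFDerivAt_equiv hs'
  have hmul : Tendsto (fun t => ζ * s t) (𝓝 u) (𝓝 (s u)) := by
    have : ContinuousAt (fun t => ζ * s t) u := continuousAt_const.mul hs.continuousAt
    simpa [ContinuousAt, hsu] using this
  have hσ : Tendsto (fun t => hinv.localInverse _ _ _ (ζ * s t)) (𝓝 u) (𝓝 u) :=
    hinv.localInverse_tendsto.comp hmul
  have hsσ : ∀ᶠ t in 𝓝 u, s (hinv.localInverse _ _ _ (ζ * s t)) = ζ * s t :=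
    hmul.eventually hinv.eventually_right_inverse
  have hep := eventually_eval_comp_eq hf hp hs hspow hσ hsσ
    ((hζ.pow_eq_one_iff_dvd _).mpr (Nat.gcd_dvd_left _ _))
  have heq' := eventually_eval_comp_eq hg hq hs (heq ▸ hspow) hσ hsσ
    ((hζ.pow_eq_one_iff_dvd _).mpr (Nat.gcd_dvd_right _ _))
  have hbev : ∀ᶠ t in 𝓝[≠] u, b.eval t ≠ 0 := by
    have hfin : (b.rootSet ℂ \ {u}).Finite := (b.rootSet_finite ℂ).subset Set.sdiff_subset
    have : ∀ᶠ t in 𝓝 u, t ∉ b.rootSet ℂ \ {u} :=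
      hfin.isClosed.isOpen_compl.mem_nhds (by simp)
    rw [eventually_nhdsWithin_iff]
    filter_upwards [this] with t ht htu h0
    exact ht ⟨by simp [mem_rootSet, hb, h0], htu⟩
  have hleft : ∀ᶠ t in 𝓝[≠] u, hinv.localInverse _ _ _ (s t) = t :=
    hinv.eventually_left_inverse.filter_mono nhdsWithin_le_nhds
  obtain ⟨t, ht, ⟨⟨h1, h2⟩, h3⟩, h4, h5⟩ := (eventually_mem_nhdsWithin.and
    ((((hep.and heq').and hsσ).filter_mono nhdsWithin_le_nhds).and (hbev.and hleft))).exists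
  rw [hinj _ _ h4 h1 h2] at h3
  have hst : s t = 0 := by
    have : (1 - ζ) * s t = 0 := by linear_combination h3
    exact (mul_eq_zero.mp this).resolve_left (sub_ne_zero.mpr hζ1.symm)
  apply ht
  have := hinv.localInverse_apply_image
  rw [hsu] at this
  rw [hst] at h5
  exact h5.symm.trans this

theorem monic_C_inv_mul_map_C_sub_C {K : Type*} [Field K] {h : K[X]} (hh : 0 < h.natDegree)
    (a : K[X]) : (C (C h.leadingCoeff⁻¹) * (h.map C - C a)).Monic := by
  have hl : h.leadingCoeff ≠ 0 := leadingCoeff_ne_zero.mpr (ne_zero_of_natDegree_gt hh)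
  have hm : (h.map (C : K →+* K[X])).natDegree = h.natDegree :=
    natDegree_map_eq_of_injective C_injective _
  have : (h.map C - C a).leadingCoeff = C h.leadingCoeff := by
    rw [leadingCoeff_sub_of_degree_lt, leadingCoeff_map_of_injective C_injective]
    refine degree_C_le.trans_lt (natDegree_pos_iff_degree_pos.mp (hm ▸ hh))
  rw [Monic, leadingCoeff_mul, this, leadingCoeff_C, ← C_mul, inv_mul_cancel₀ hl, C_1]

theorem isIntegral_compRingHom {K : Type*} [Field K] {p : K[X]} (hp : 0 < p.natDegree) :
    (compRingHom p).IsIntegral := by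
  have hX : (compRingHom p).IsIntegralElem X := by
    refine ⟨_, monic_C_inv_mul_map_C_sub_C hp X, ?_⟩
    have : (compRingHom p).comp C = C := by ext; simp
    rw [eval₂_mul, eval₂_sub, eval₂_map, this, eval₂_C_X]
    simp
  intro h
  induction h using Polynomial.induction_on with
  | C a => simpa using (compRingHom p).isIntegralElem_map (x := C a)
  | add a b ha hb => exact ha.add _ hb
  | monomial n a ih =>
    rw [pow_succ, ← mul_assoc]
    exact ih.mul _ hX

theorem compRingHom_injective {K : Type*} [Field K] {p : K[X]} (hp : 0 < p.natDegree) :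
    Function.Injective (compRingHom p) := by
  rw [injective_iff_map_eq_zero]
  intro a ha
  rw [coe_compRingHom_apply, comp_eq_zero_iff] at ha
  refine ha.resolve_right fun h => ?_
  rw [h.2, natDegree_C] at hp
  exact hp.false

theorem Irreducible.dvd_of_eval₂_eq_zero {R S : Type*} [CommRing R] [IsDomain R]
    [IsIntegrallyClosed R] [CommRing S] [IsDomain S] {φ : R →+* S} (hφ : Function.Injective φ)
    {s : S} (hs : φ.IsIntegralElem s) {F G : R[X]} (hF : Irreducible F)
    (hF0 : F.eval₂ φ s = 0) (hG0 : G.eval₂ φ s = 0) : F ∣ G := by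
  let _ := φ.toAlgebra
  have : FaithfulSMul R S := (faithfulSMul_iff_algebraMap_injective R S).mpr hφ
  have hint : IsIntegral R s := hs
  have hdF : minpoly R s ∣ F := minpoly.isIntegrallyClosed_dvd hint hF0
  have hdG : minpoly R s ∣ G := minpoly.isIntegrallyClosed_dvd hint hG0
  obtain h | h := (hF.dvd_iff.mp hdF)
  · exact absurd h (minpoly.not_isUnit R s)
  · exact h.dvd.trans hdG

/-- The map `t ↦ (p t, q t)` is onto the irreducible curve `f(x) = g(y)`. -/
theorem exists_eval_eq_eval_eq {f g p q : ℂ[X]} (hp : 0 < p.natDegree)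
    (heq : f.comp p = g.comp q) (hirr : Irreducible (curvePoly f g)) {x z : ℂ}
    (hxz : f.eval x = g.eval z) : ∃ u, p.eval u = x ∧ q.eval u = z := by
  set ψ : ℂ[X][X] →+* ℂ[X] := eval₂RingHom (compRingHom p) q
  have hψC : ψ.comp C = compRingHom p := by ext <;> simp [ψ]
  have hψ : ψ.IsIntegral := RingHom.IsIntegral.tower_top C ψ (hψC ▸ isIntegral_compRingHom hp)
  have hcurve : ψ (curvePoly f g) = 0 := by
    have : (compRingHom p).comp C = C := by ext; simp
    simp only [ψ, curvePoly, coe_eval₂RingHom, eval₂_sub, eval₂_C, eval₂_map, this]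
    rw [coe_compRingHom_apply, heq, sub_eq_zero]
    rfl
  have hker : RingHom.ker ψ ≤ RingHom.ker (evalEvalRingHom x z) := by
    intro G hG
    have hd : curvePoly f g ∣ G := hirr.dvd_of_eval₂_eq_zero (compRingHom_injective hp)
      (isIntegral_compRingHom hp q) hcurve hG
    rw [RingHom.mem_ker, coe_evalEvalRingHom]
    have h0 : (curvePoly f g).evalEval x z = 0 := by
      simp [curvePoly, evalEval_sub, evalEval_C, evalEval_map_C, hxz]
    exact zero_dvd_iff.mp (h0 ▸ evalEval_dvd x z hd)
  by_contra! H
  have hco : IsCoprime (p - C x) (q - C z) := by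
    refine (isCoprime_iff_aeval_ne_zero_of_isAlgClosed ℂ ℂ _ _).mpr fun u => ?_
    by_cases hu : p.eval u = x
    · exact Or.inr (by simpa [sub_eq_zero] using H u hu)
    · exact Or.inl (by simpa [sub_eq_zero] using hu)
  have htop : (RingHom.ker (evalEvalRingHom x z)).map ψ = ⊤ := by
    obtain ⟨a, b, hab⟩ := hco
    rw [Ideal.eq_top_iff_one, ← hab]
    refine Ideal.add_mem _ (Ideal.mul_mem_left _ _ ?_) (Ideal.mul_mem_left _ _ ?_)
    · have : p - C x = ψ (C (X - C x)) := by simp [ψ]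
      rw [this]
      exact Ideal.mem_map_of_mem _ (by simp [RingHom.mem_ker])
    · have : q - C z = ψ (X - C (C z)) := by simp [ψ]
      rw [this]
      exact Ideal.mem_map_of_mem _ (by simp [RingHom.mem_ker])
  rw [Ideal.map_eq_top_iff_of_ker_le ψ hker hψ] at htop
  exact RingHom.ker_ne_top _ htop

theorem coeff_coeff_swap {R : Type*} [CommSemiring R] (m : R[X][X]) (i j : ℕ) :
    ((Bivariate.swap m).coeff i).coeff j = (m.coeff j).coeff i := by
  induction m using Polynomial.induction_on' with
  | add a b ha hb => simp [ha, hb]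
  | monomial n a =>
    induction a using Polynomial.induction_on' with
    | add a b ha hb => simp [ha, hb]
    | monomial k r =>
      rw [Bivariate.swap_monomial_monomial]
      simp only [coeff_monomial]
      split_ifs <;> simp_all [coeff_monomial]

theorem Polynomial.Monic.dvd_of_dvd_C_mul {R : Type*} [CommRing R] [IsDomain R] {m G : R[X]}
    (hm : m.Monic) {a : R} (ha : a ≠ 0) (h : m ∣ C a * G) : m ∣ G := by
  rw [← modByMonic_eq_zero_iff_dvd hm, ← smul_eq_C_mul, smul_modByMonic] at h
  exact (modByMonic_eq_zero_iff_dvd hm).mp ((smul_eq_zero.mp h).resolve_left ha)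

/-- If `W(Y) - W(X)` divides `h(Y) - h(X)`, then `h` is a polynomial in `W`. -/
theorem exists_eq_comp_of_dvd {K : Type*} [Field K] {W : K[X]} (hW : 0 < W.natDegree)
    {h : K[X]} (hd : W.map C - C W ∣ h.map C - C h) : ∃ h₁ : K[X], h = h₁.comp W := by
  induction hn : h.natDegree using Nat.strong_induction_on generalizing h with
  | _ n ih =>
  rcases Nat.eq_zero_or_pos n with rfl | hpos
  · rw [natDegree_eq_zero] at hn
    obtain ⟨c, rfl⟩ := hn
    exact ⟨C c, by simp⟩
  have hW0 : W - C (W.eval 0) ≠ 0 := fun H => by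
    rw [sub_eq_zero.mp H, natDegree_C] at hW
    exact hW.false
  obtain ⟨s, hs⟩ : W - C (W.eval 0) ∣ h - C (h.eval 0) := by
    have hC : (evalRingHom (0 : K)).comp C = RingHom.id K := by ext; simp
    have := map_dvd (mapRingHom (evalRingHom (0 : K))) hd
    simpa [Polynomial.map_map, hC] using this
  have hs0 : s ≠ 0 := by
    rintro rfl
    rw [mul_zero, sub_eq_zero] at hs
    rw [hs, natDegree_C] at hn
    omega
  have hdeg : s.natDegree < n := by
    have := congrArg natDegree hs
    rw [natDegree_mul hW0 hs0, natDegree_sub_C, natDegree_sub_C] at this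
    omega
  have hh : h = C (h.eval 0) + (W - C (W.eval 0)) * s := by rw [← hs]; ring
  have hds : W.map C - C W ∣ s.map C - C s := by
    have hm := monic_C_inv_mul_map_C_sub_C hW W
    have hu : IsUnit (C (C W.leadingCoeff⁻¹) : K[X][X]) := by
      rw [isUnit_C, isUnit_C]
      exact (inv_ne_zero (leadingCoeff_ne_zero.mpr (ne_zero_of_natDegree_gt hW))).isUnit
    rw [← hu.mul_left_dvd] at hd ⊢
    refine hm.dvd_of_dvd_C_mul hW0 ?_
    have e : C (W - C (W.eval 0)) * (s.map C - C s) =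
        (h.map C - C h) - (W.map C - C W) * s.map C := by
      rw [hh]
      simp
      ring
    rw [e]
    exact dvd_sub hd ((hu.mul_left_dvd.mpr dvd_rfl).mul_right _)
  obtain ⟨s₁, hs₁⟩ := ih _ hdeg hds rfl
  refine ⟨C (h.eval 0) + (X - C (W.eval 0)) * s₁, ?_⟩
  rw [add_comp, mul_comp, sub_comp, X_comp, C_comp, C_comp, ← hs₁]
  exact hh

theorem associated_of_dvd_of_coeff {K : Type*} [Field K] {m : K[X][X]} {i : ℕ}
    (hi : 0 < (m.coeff i).natDegree) (hd : m ∣ (m.coeff i).map C - C (m.coeff i)) :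
    Associated m ((m.coeff i).map C - C (m.coeff i)) := by
  set W := m.coeff i with hWdef
  obtain ⟨Q, hQ⟩ := hd
  have hWl : W.leadingCoeff ≠ 0 := leadingCoeff_ne_zero.mpr (ne_zero_of_natDegree_gt hi)
  have hsw : C W - W.map C = Bivariate.swap m * Bivariate.swap Q := by
    rw [← map_mul, ← hQ, map_sub, Bivariate.swap_map_C, Bivariate.swap_C]
  have hnd : (C W - W.map C).natDegree = W.natDegree := by
    rw [← neg_sub, natDegree_neg, natDegree_sub_C, natDegree_map_eq_of_injective C_injective]
  have hne : Bivariate.swap m * Bivariate.swap Q ≠ 0 := by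
    rw [← hsw]
    intro H
    rw [H, natDegree_zero] at hnd
    omega
  have hle : W.natDegree ≤ (Bivariate.swap m).natDegree := by
    refine le_natDegree_of_ne_zero fun H => hWl ?_
    have := coeff_coeff_swap m W.natDegree i
    rw [H, coeff_zero, ← hWdef] at this
    exact this.symm
  have hQ0 : (Bivariate.swap Q).natDegree = 0 := by
    rw [hsw, natDegree_mul (left_ne_zero_of_mul hne) (right_ne_zero_of_mul hne)] at hnd
    omega
  obtain ⟨b, hb⟩ := natDegree_eq_zero.mp hQ0
  have hbu : IsUnit b := by
    have hbd : C b ∣ C W - W.map C := ⟨Bivariate.swap m, by rw [hsw, hb, mul_comm]⟩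
    have := (C_dvd_iff_dvd_coeff _ _).mp hbd W.natDegree
    rw [coeff_sub, coeff_C_of_ne_zero hi.ne', coeff_map, zero_sub, dvd_neg] at this
    exact isUnit_of_dvd_unit this (isUnit_C.mpr (Ne.isUnit hWl))
  have hQu : IsUnit Q := by
    have h1 : IsUnit (Bivariate.swap Q) := hb ▸ isUnit_C.mpr hbu
    simpa using h1.map (Bivariate.swap (R := K))
  exact ⟨hQu.unit, hQ.symm⟩

/-- If `p` and `q` have no nontrivial common right compositional factor, then `t ↦ (p t, q t)` is
injective outside the zeros of some nonzero polynomial. -/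
theorem exists_injective_of_noCommonRightFactor {p q : ℂ[X]} (hp : 0 < p.natDegree)
    (hnc : NoCommonRightFactor p q) : ∃ b : ℂ[X], b ≠ 0 ∧
      ∀ t t', b.eval t ≠ 0 → p.eval t' = p.eval t → q.eval t' = q.eval t → t' = t := by
  let ι := algebraMap ℂ[X] (RatFunc ℂ)
  have hι : Function.Injective ι := FaithfulSMul.algebraMap_injective _ _
  let L := IntermediateField.adjoin ℂ {ι p, ι q}
  have hpL : ι p ∈ L := IntermediateField.subset_adjoin _ _ (by simp)
  have hqL : ι q ∈ L := IntermediateField.subset_adjoin _ _ (by simp)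
  set x : RatFunc ℂ := ι X with hx
  have hLK : (algebraMap L (RatFunc ℂ)).comp (algebraMap ℂ L) = ι.comp C := by
    ext a
    exact ((IsScalarTower.algebraMap_apply ℂ L _ a).symm.trans
      (IsScalarTower.algebraMap_apply ℂ ℂ[X] _ a))
  have hmap (h : ℂ[X]) (hh : ι h ∈ L) : (h.map (algebraMap ℂ L) - C (⟨ι h, hh⟩ : L)).map
      (algebraMap L (RatFunc ℂ)) = (h.map C - C h).map ι := by
    simp only [Polynomial.map_sub, Polynomial.map_map, hLK, map_C]
    rfl
  have hroot (h : ℂ[X]) (hh : ι h ∈ L) :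
      aeval x (h.map (algebraMap ℂ L) - C (⟨ι h, hh⟩ : L)) = 0 := by
    rw [← eval_map_algebraMap, hmap, hx, eval_map_apply]
    simp [eval_map, eval₂_C_X]
  have hint : IsIntegral L x := by
    refine IsAlgebraic.isIntegral ⟨_, ?_, hroot p hpL⟩
    refine ne_zero_of_natDegree_gt (n := 0) ?_
    rwa [natDegree_sub_C, natDegree_map]
  set M := minpoly L x
  have hMm : (M.map (algebraMap L (RatFunc ℂ))).Monic := (minpoly.monic hint).map _
  have hdvd (h : ℂ[X]) (hh : ι h ∈ L) :
      M.map (algebraMap L (RatFunc ℂ)) ∣ (h.map C - C h).map ι := by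
    rw [← hmap h hh]
    exact Polynomial.map_dvd _ (minpoly.dvd _ _ (hroot h hh))
  obtain ⟨m, hm⟩ : ∃ m : ℂ[X][X], m.map ι = M.map (algebraMap L (RatFunc ℂ)) := by
    obtain ⟨m, hm⟩ := IsIntegrallyClosed.eq_map_mul_C_of_dvd (RatFunc ℂ)
      (monic_C_inv_mul_map_C_sub_C hp p) (g := M.map (algebraMap L (RatFunc ℂ))) (by
        rw [Polynomial.map_mul]
        exact (hdvd p hpL).mul_left _)
    rw [hMm.leadingCoeff, C_1, mul_one] at hm
    exact ⟨m, hm⟩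
  have hmm : m.Monic := monic_of_injective hι (hm ▸ hMm)
  have hmd (h : ℂ[X]) (hh : ι h ∈ L) : m ∣ h.map C - C h := by
    rw [← map_dvd_map ι hι hmm, hm]
    exact hdvd h hh
  have hcoeff (i : ℕ) : ι (m.coeff i) ∈ L := by
    rw [← coeff_map, hm, coeff_map]
    exact (M.coeff i).2
  obtain ⟨i, hi⟩ : ∃ i, 0 < (m.coeff i).natDegree := by
    by_contra! H
    obtain ⟨m₀, rfl⟩ : ∃ m₀ : ℂ[X], m₀.map C = m := by
      refine (mem_map_range (C : ℂ →+* ℂ[X])).mpr fun i => ?_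
      obtain ⟨c, hc⟩ := natDegree_eq_zero.mp (Nat.le_zero.mp (H i))
      exact ⟨c, hc⟩
    have h0 : ι ((m₀.map C).eval X) = 0 := by
      rw [← eval_map_apply, hm, ← hx, eval_map_algebraMap]
      exact minpoly.aeval _ _
    rw [map_eq_zero_iff _ hι, eval_map, eval₂_C_X] at h0
    exact hmm.ne_zero (by rw [h0, Polynomial.map_zero])
  have hass := associated_of_dvd_of_coeff hi (hmd _ (hcoeff i))
  obtain ⟨p₁, hp₁⟩ := exists_eq_comp_of_dvd hi (hass.symm.dvd.trans (hmd p hpL))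
  obtain ⟨q₁, hq₁⟩ := exists_eq_comp_of_dvd hi (hass.symm.dvd.trans (hmd q hqL))
  have hW := hnc _ _ _ hp₁ hq₁
  have hdeg : M.natDegree = 1 := by
    have h1 : m.natDegree = (m.coeff i).natDegree := by
      rw [natDegree_eq_of_degree_eq (degree_eq_degree_of_associated hass), natDegree_sub_C,
        natDegree_map_eq_of_injective C_injective]
    have h2 : m.natDegree = M.natDegree := by
      rw [← natDegree_map_eq_of_injective hι, hm, natDegree_map]
    omega
  obtain ⟨⟨y, hyL⟩, hy⟩ := minpoly.natDegree_eq_one_iff.mp hdeg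
  have hxL : x ∈ L := by rw [← hy]; exact hyL
  obtain ⟨r, hr, s, hs, hrs⟩ := IntermediateField.mem_adjoin_iff_div.mp hxL
  have himg : Algebra.adjoin ℂ {ι p, ι q} =
      (Algebra.adjoin ℂ {p, q}).map (IsScalarTower.toAlgHom ℂ ℂ[X] (RatFunc ℂ)) := by
    rw [AlgHom.map_adjoin, Set.image_pair]
    rfl
  rw [himg] at hr hs
  obtain ⟨a, ha, rfl⟩ := hr
  obtain ⟨b, hb, rfl⟩ := hs
  change x = ι a / ι b at hrs
  have hb0 : b ≠ 0 := by
    rintro rfl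
    rw [map_zero, div_zero, hx, map_eq_zero_iff _ hι] at hrs
    exact X_ne_zero hrs
  have hXb : X * b = a := hι (by
    rw [map_mul, ← hx, hrs, div_mul_cancel₀ _ ((map_ne_zero_iff _ hι).mpr hb0)])
  refine ⟨b, hb0, fun t t' ht hpt hqt => ?_⟩
  have hinv : Algebra.adjoin ℂ {p, q} ≤ AlgHom.equalizer (aeval t') (aeval t) :=
    Algebra.adjoin_le (by rintro _ (rfl | rfl) <;> simpa [AlgHom.mem_equalizer])
  have ha' : a.eval t' = a.eval t := by simpa using hinv ha
  have hb' : b.eval t' = b.eval t := by simpa using hinv hb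
  rw [← hXb, eval_mul, eval_mul, eval_X, eval_X, hb'] at ha'
  exact mul_right_cancel₀ ht ha'

theorem stmt_16 (f g p q : Polynomial ℂ)
    (hf : 0 < f.natDegree) (hg : 0 < g.natDegree)
    (hp : 0 < p.natDegree) (hq : 0 < q.natDegree)
    (heq : f.comp p = g.comp q)
    (hirr : Irreducible (curvePoly f g))
    (hnc : NoCommonRightFactor p q) :
    ∀ z : ℂ,
      nuPoly f (g.eval z) = nuPoly q z * Nat.gcd (localDeg g z) (nuPoly f (g.eval z)) := by
  intro z
  obtain ⟨b, hb, hinj⟩ := exists_injective_of_noCommonRightFactor hp hnc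
  set m := localDeg g z
  set E := nuPoly f (g.eval z)
  have hm : 0 < m := localDeg_pos_s16 hg z
  have hfib (u : ℂ) (hu : q.eval u = z) (k : ℕ) :
      localDeg q u ∣ k ↔ localDeg f (p.eval u) ∣ k * m := by
    have hco := coprime_localDeg hf hg hp hq heq hb hinj u
    have hmul : localDeg p u * localDeg f (p.eval u) = localDeg q u * m := by
      rw [← localDeg_comp hf hp, heq, localDeg_comp hg hq, hu]
    obtain ⟨c, hc⟩ := hco.symm.dvd_of_dvd_mul_left (Dvd.intro _ hmul.symm)
    have hm' : m = localDeg p u * c := by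
      rw [hc] at hmul
      refine Nat.eq_of_mul_eq_mul_left (localDeg_pos_s16 hq u) ?_
      rw [← hmul]
      ring
    have hc0 : c ≠ 0 := by
      rintro rfl
      exact hm.ne' hm'
    rw [hc, hm', ← mul_assoc, Nat.mul_dvd_mul_iff_right hc0.bot_lt, hco.symm.dvd_mul_right]
  have hiff (k : ℕ) : nuPoly q z ∣ k ↔ E ∣ k * m := by
    rw [nuPoly_dvd_iff hq, nuPoly_dvd_iff hf]
    constructor
    · intro H x hx
      obtain ⟨u, rfl, hu⟩ := exists_eval_eq_eval_eq hp heq hirr hx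
      exact (hfib u hu k).mp (H u hu)
    · intro H u hu
      refine (hfib u hu k).mpr (H _ ?_)
      rw [← eval_comp, heq, eval_comp, hu]
  have hgpos : 0 < m.gcd E := Nat.gcd_pos_of_pos_left _ hm
  have hνE : nuPoly q z = E / m.gcd E := by
    refine Nat.dvd_right_iff_eq.mp fun k => ?_
    rw [hiff, Nat.div_dvd_iff_dvd_mul (Nat.gcd_dvd_right m E) hgpos]
    rw [mul_comm k m, ← Nat.dvd_gcd_mul_iff_dvd_mul, Nat.gcd_comm E m]
  rw [hνE, Nat.div_mul_cancel (Nat.gcd_dvd_right m E)]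
end
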